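/- Let β⃗ be sub-critical and X ~ ERGM(β⃗) on 𝒢_n. For every fixed positive integer k there is a constant C > 0 such that for all sufficiently large n and any k distinct edges i_1,…,i_k of K_n, |𝔼[X_{i_1} X_{i_2} ⋯ X_{i_k}] − (𝔼 X_{i_1})(𝔼 X_{i_2}) ⋯ (𝔼 X_{i_k})| ≤ C/n. -/

import Mathlib

open Finset MeasureTheory Filter
open scoped ENNReal NNReal

namespace ERGM

/-- The set of edges of the complete graph on `Fin n`: non-diagonal unordered pairs. -/
abbrev EdgeSet (n : ℕ) : Type := {p : Sym2 (Fin n) // ¬ p.IsDiag}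

/-- A configuration (graph on `n` vertices): an assignment of `true/false` to each edge. -/
abbrev Config (n : ℕ) : Type := EdgeSet n → Bool

/-- The value of the configuration `x` on the (unordered) pair `{i,j}`; `false` for `i = j`. -/
noncomputable def edgeVal {n : ℕ} (x : Config n) (i j : Fin n) : Bool :=
  if h : (s(i, j) : Sym2 (Fin n)).IsDiag then false else x ⟨s(i, j), h⟩

/-- Real-valued indicator of presence of the edge `{i,j}` in `x`. -/
noncomputable def edgeInd {n : ℕ} (x : Config n) (i j : Fin n) : ℝ :=
  if edgeVal x i j = true then 1 else 0

open scoped Classical in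
/-- Subgraph counting number `N_G(x)`: the number of copies of `G` in `x` (times the
number of automorphisms), i.e. the sum over injective `ψ` of the product of edge
indicators (each edge indicator is idempotent, so counting ordered adjacent pairs
yields the same value as counting edges). -/
noncomputable def NG {n m : ℕ} (G : SimpleGraph (Fin m)) (x : Config n) : ℝ :=
  ∑ ψ : Fin m ↪ Fin n, ∏ a : Fin m, ∏ b : Fin m,
    if G.Adj a b then edgeInd x (ψ a) (ψ b) else 1

/-- The Hamiltonian `H(x) = Σ_i β_i N_{G_i}(x) / n^{|V_i|-2}`. -/
noncomputable def Hamiltonian {n s : ℕ} (V : Fin s → ℕ)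
    (G : ∀ i, SimpleGraph (Fin (V i))) (β : Fin s → ℝ) (x : Config n) : ℝ :=
  ∑ i, β i * NG (G i) x / (n : ℝ) ^ (V i - 2)

/-- The ERGM probability mass function `π(x) ∝ exp(H(x))`. -/
noncomputable def ergmProb {n s : ℕ} (V : Fin s → ℕ)
    (G : ∀ i, SimpleGraph (Fin (V i))) (β : Fin s → ℝ) (x : Config n) : ℝ :=
  Real.exp (Hamiltonian V G β x) / ∑ y : Config n, Real.exp (Hamiltonian V G β y)

/-- Expectation of `f` with respect to the mass function `w`. -/
noncomputable def expect {n : ℕ} (w : Config n → ℝ) (f : Config n → ℝ) : ℝ :=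
  ∑ x : Config n, w x * f x

open scoped Classical in
/-- Probability of the event `A` with respect to the mass function `w`. -/
noncomputable def prob {n : ℕ} (w : Config n → ℝ) (A : Config n → Prop) : ℝ :=
  ∑ x : Config n, if A x then w x else 0

/-- The number of edges `|E(G)|` of a finite graph. -/
noncomputable def numEdges {m : ℕ} (G : SimpleGraph (Fin m)) : ℕ := G.edgeSet.ncard

/-- `Ψ_β(p) = Σ_i 2 β_i |E_i| p^{|E_i|-1}`. -/
noncomputable def Psi {s : ℕ} (V : Fin s → ℕ) (G : ∀ i, SimpleGraph (Fin (V i)))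
    (β : Fin s → ℝ) (p : ℝ) : ℝ :=
  ∑ i, 2 * β i * (numEdges (G i) : ℝ) * p ^ (numEdges (G i) - 1)

/-- `Φ(u) = e^u / (1 + e^u)`. -/
noncomputable def Phi (u : ℝ) : ℝ := Real.exp u / (1 + Real.exp u)

/-- `φ_β(p) = Φ(Ψ_β(p))`. -/
noncomputable def phiFn {s : ℕ} (V : Fin s → ℕ) (G : ∀ i, SimpleGraph (Fin (V i)))
    (β : Fin s → ℝ) : ℝ → ℝ := fun p => Phi (Psi V G β p)

/-- `β` is sub-critical (high temperature) with fixed point `p`: `p` is the unique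
solution of `φ_β(p) = p` and it satisfies `φ_β'(p) < 1`. -/
def Subcritical {s : ℕ} (V : Fin s → ℕ) (G : ∀ i, SimpleGraph (Fin (V i)))
    (β : Fin s → ℝ) (p : ℝ) : Prop :=
  phiFn V G β p = p ∧ (∀ q : ℝ, phiFn V G β q = q → q = p) ∧
    deriv (phiFn V G β) p < 1

/-- The discrete derivative `∂_e H(x) = H(x_{e+}) - H(x_{e-})`. -/
noncomputable def dHam {n s : ℕ} (V : Fin s → ℕ) (G : ∀ i, SimpleGraph (Fin (V i)))
    (β : Fin s → ℝ) (e : EdgeSet n) (x : Config n) : ℝ :=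
  Hamiltonian V G β (Function.update x e true) - Hamiltonian V G β (Function.update x e false)

/-- Real-valued indicator `X_e` of presence of edge `e`. -/
noncomputable def edgeX {n : ℕ} (e : EdgeSet n) (x : Config n) : ℝ := if x e = true then 1 else 0

/-- Two edges of `K_n` share a vertex. -/
def ShareVertex {n : ℕ} (e f : EdgeSet n) : Prop := ∃ v : Fin n, v ∈ e.1 ∧ v ∈ f.1

/-! ### Averages and covariances on the Boolean cube -/

section Cube

variable {ι : Type*}

/-- Real-valued indicator of the coordinate `e`. -/
noncomputable def bit (e : ι) (x : ι → Bool) : ℝ := if x e = true then 1 else 0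

lemma bit_nonneg (e : ι) (x : ι → Bool) : 0 ≤ bit e x := by
  unfold bit; split_ifs <;> norm_num

lemma bit_le_one (e : ι) (x : ι → Bool) : bit e x ≤ 1 := by
  unfold bit; split_ifs <;> norm_num

lemma bit_mono (e : ι) : Monotone (bit e) := by
  intro x y h
  unfold bit
  split_ifs with h1 h2
  · exact le_rfl
  · exact absurd (Bool.eq_true_of_true_le (h1 ▸ h e)) h2
  · exact zero_le_one
  · exact le_rfl

/-- Indicator that all coordinates in `A` are present. -/
noncomputable def allInd (A : Finset ι) (x : ι → Bool) : ℝ :=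
  if ∀ f ∈ A, x f = true then 1 else 0

lemma allInd_nonneg (A : Finset ι) (x : ι → Bool) : 0 ≤ allInd A x := by
  unfold allInd; split_ifs <;> norm_num

lemma allInd_le_one (A : Finset ι) (x : ι → Bool) : allInd A x ≤ 1 := by
  unfold allInd; split_ifs <;> norm_num

lemma allInd_mono (A : Finset ι) : Monotone (allInd A) := by
  intro x y h
  unfold allInd
  split_ifs with h1 h2
  · exact le_rfl
  · exact absurd (fun f hf => Bool.eq_true_of_true_le (h1 f hf ▸ h f)) h2
  · exact zero_le_one
  · exact le_rfl

variable [DecidableEq ι]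

lemma allInd_update_true (A : Finset ι) (e : ι) (x : ι → Bool) :
    allInd A (Function.update x e true) = allInd (A.erase e) x := by
  unfold allInd
  congr 1
  refine propext ⟨fun h f hf => ?_, fun h f hf => ?_⟩
  · have := h f (mem_of_mem_erase hf)
    rwa [Function.update_of_ne (ne_of_mem_erase hf)] at this
  · by_cases hfe : f = e
    · subst hfe; simp
    · rw [Function.update_of_ne hfe]; exact h f (mem_erase.2 ⟨hfe, hf⟩)

lemma allInd_update_false {A : Finset ι} {e : ι} (he : e ∈ A) (x : ι → Bool) :
    allInd A (Function.update x e false) = 0 := by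
  unfold allInd
  rw [if_neg]
  intro h
  simpa using h e he

lemma allInd_update_of_notMem {A : Finset ι} {e : ι} (he : e ∉ A) (x : ι → Bool) (b : Bool) :
    allInd A (Function.update x e b) = allInd A x := by
  unfold allInd
  congr 1
  refine propext (forall₂_congr fun f hf => ?_)
  rw [Function.update_of_ne (by rintro rfl; exact he hf)]

lemma allInd_sub_update (A : Finset ι) (e : ι) (x : ι → Bool) :
    allInd A (Function.update x e true) - allInd A (Function.update x e false) =
      if e ∈ A then allInd (A.erase e) x else 0 := by
  split_ifs with h
  · rw [allInd_update_true, allInd_update_false h, sub_zero]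
  · rw [allInd_update_of_notMem h, allInd_update_of_notMem h, sub_self]

omit [DecidableEq ι] in
lemma allInd_supermodular (A : Finset ι) (x y : ι → Bool) :
    allInd A x + allInd A y ≤ allInd A (x ⊓ y) + allInd A (x ⊔ y) := by
  by_cases hx : ∀ f ∈ A, x f = true <;> by_cases hy : ∀ f ∈ A, y f = true
  · have h1 : ∀ f ∈ A, (x ⊓ y) f = true := fun f hf => by simp [hx f hf, hy f hf]
    have h2 : ∀ f ∈ A, (x ⊔ y) f = true := fun f hf => by simp [hx f hf]
    simp only [allInd, if_pos hx, if_pos hy, if_pos h1, if_pos h2, le_refl]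
  · have h1 := allInd_nonneg A (x ⊓ y)
    have h2 := allInd_mono A (le_sup_left : x ≤ x ⊔ y)
    have h3 : allInd A y = 0 := if_neg hy
    linarith
  · have h1 := allInd_nonneg A (x ⊓ y)
    have h2 := allInd_mono A (le_sup_right : y ≤ x ⊔ y)
    have h3 : allInd A x = 0 := if_neg hx
    linarith
  · have h1 := allInd_nonneg A (x ⊓ y)
    have h2 := allInd_nonneg A (x ⊔ y)
    have h3 : allInd A x = 0 := if_neg hx
    have h4 : allInd A y = 0 := if_neg hy
    linarith

/-- The indicator of `A` drops between `x` and `y` only if some coordinate of `A` does. -/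
lemma allInd_sub_le (A : Finset ι) {x y : ι → Bool} (h : y ≤ x) :
    allInd A x - allInd A y ≤ ∑ f ∈ A, (bit f x - bit f y) * allInd (A.erase f) x := by
  have hnn : ∀ f ∈ A, 0 ≤ (bit f x - bit f y) * allInd (A.erase f) x := fun f _ =>
    mul_nonneg (sub_nonneg.2 (bit_mono f h)) (allInd_nonneg _ _)
  by_cases hx : ∀ f ∈ A, x f = true
  · by_cases hy : ∀ f ∈ A, y f = true
    · rw [show allInd A x = 1 from if_pos hx, show allInd A y = 1 from if_pos hy, sub_self]
      exact sum_nonneg hnn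
    · push Not at hy
      obtain ⟨f, hf, hfy⟩ := hy
      refine le_trans ?_ (single_le_sum hnn hf)
      have h1 : allInd (A.erase f) x = 1 := if_pos fun g hg => hx g (mem_of_mem_erase hg)
      have h2 : bit f x = 1 := if_pos (hx f hf)
      have h3 : bit f y = 0 := if_neg hfy
      rw [h1, h2, h3]
      have := allInd_nonneg A y
      have := allInd_le_one A x
      linarith
  · rw [show allInd A x = 0 from if_neg hx]
    have := allInd_nonneg A y
    have := sum_nonneg hnn
    linarith

variable [Fintype ι]

/-- Average of `f` with respect to the weight `μ` on the Boolean cube. -/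
noncomputable def mean (μ : (ι → Bool) → ℝ) (f : (ι → Bool) → ℝ) : ℝ := ∑ x, μ x * f x

/-- Covariance of `f` and `g` with respect to the weight `μ`. -/
noncomputable def cov (μ f g : (ι → Bool) → ℝ) : ℝ :=
  mean μ (fun x => f x * g x) - mean μ f * mean μ g

/-- `μ` is a probability mass function. -/
structure IsPMF (μ : (ι → Bool) → ℝ) : Prop where
  nonneg : ∀ x, 0 ≤ μ x
  sum_eq : ∑ x, μ x = 1

variable {μ : (ι → Bool) → ℝ}

lemma mean_add (f g : (ι → Bool) → ℝ) :
    mean μ (fun x => f x + g x) = mean μ f + mean μ g := by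
  simp only [mean, mul_add, sum_add_distrib]

lemma mean_sub (f g : (ι → Bool) → ℝ) :
    mean μ (fun x => f x - g x) = mean μ f - mean μ g := by
  simp only [mean, mul_sub, sum_sub_distrib]

lemma mean_const_mul (c : ℝ) (f : (ι → Bool) → ℝ) :
    mean μ (fun x => c * f x) = c * mean μ f := by
  simp only [mean, mul_sum]
  exact sum_congr rfl fun x _ => by ring

lemma mean_sum {κ : Type*} (s : Finset κ) (f : κ → (ι → Bool) → ℝ) :
    mean μ (fun x => ∑ k ∈ s, f k x) = ∑ k ∈ s, mean μ (f k) := by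
  simp only [mean, mul_sum]
  exact sum_comm

lemma IsPMF.mean_const (hμ : IsPMF μ) (c : ℝ) : mean μ (fun _ => c) = c := by
  simp only [mean, ← sum_mul, hμ.sum_eq, one_mul]

lemma IsPMF.mean_mono (hμ : IsPMF μ) {f g : (ι → Bool) → ℝ} (h : ∀ x, f x ≤ g x) :
    mean μ f ≤ mean μ g :=
  sum_le_sum fun x _ => mul_le_mul_of_nonneg_left (h x) (hμ.nonneg x)

lemma IsPMF.mean_nonneg (hμ : IsPMF μ) {f : (ι → Bool) → ℝ} (h : ∀ x, 0 ≤ f x) :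
    0 ≤ mean μ f :=
  sum_nonneg fun x _ => mul_nonneg (hμ.nonneg x) (h x)

lemma IsPMF.mean_le (hμ : IsPMF μ) {f : (ι → Bool) → ℝ} {c : ℝ} (h : ∀ x, f x ≤ c) :
    mean μ f ≤ c :=
  (hμ.mean_mono h).trans_eq (hμ.mean_const c)

lemma cov_comm (f g : (ι → Bool) → ℝ) : cov μ f g = cov μ g f := by
  simp only [cov, mul_comm]

lemma cov_sub_left (f g k : (ι → Bool) → ℝ) :
    cov μ (fun x => f x - g x) k = cov μ f k - cov μ g k := by
  simp only [cov, sub_mul, mean_sub]; ring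

lemma cov_const_mul_left (c : ℝ) (f k : (ι → Bool) → ℝ) :
    cov μ (fun x => c * f x) k = c * cov μ f k := by
  simp only [cov, mul_assoc, mean_const_mul]; ring

lemma cov_sum_left {κ : Type*} (s : Finset κ) (f : κ → (ι → Bool) → ℝ) (k : (ι → Bool) → ℝ) :
    cov μ (fun x => ∑ j ∈ s, f j x) k = ∑ j ∈ s, cov μ (f j) k := by
  simp only [cov, sum_mul, mean_sum, sum_sub_distrib]

lemma cov_sum_right {κ : Type*} (s : Finset κ) (f : κ → (ι → Bool) → ℝ) (k : (ι → Bool) → ℝ) :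
    cov μ k (fun x => ∑ j ∈ s, f j x) = ∑ j ∈ s, cov μ k (f j) := by
  rw [cov_comm, cov_sum_left]; exact sum_congr rfl fun j _ => cov_comm _ _

/-- A probability mass function under which monotone functions are nonnegatively correlated. -/
def Associated (μ : (ι → Bool) → ℝ) : Prop :=
  ∀ f g : (ι → Bool) → ℝ, Monotone f → Monotone g → 0 ≤ cov μ f g

lemma IsPMF.associated_of_lattice (hμ : IsPMF μ)
    (h : ∀ x y, μ x * μ y ≤ μ (x ⊓ y) * μ (x ⊔ y)) : Associated μ := by
  intro f g hf hg
  have key := fkg (μ := μ) (f := fun x => f x - f ⊥) (g := fun x => g x - g ⊥) hμ.nonneg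
    (fun x => sub_nonneg.2 (hf bot_le)) (fun x => sub_nonneg.2 (hg bot_le))
    (fun x y hxy => sub_le_sub_right (hf hxy) _) (fun x y hxy => sub_le_sub_right (hg hxy) _) h
  rw [hμ.sum_eq, one_mul] at key
  change mean μ (fun x => f x - f ⊥) * mean μ (fun x => g x - g ⊥) ≤
    mean μ (fun x => (f x - f ⊥) * (g x - g ⊥)) at key
  have e1 : mean μ (fun x => (f x - f ⊥) * (g x - g ⊥)) =
      mean μ (fun x => f x * g x) - g ⊥ * mean μ f - f ⊥ * mean μ g + f ⊥ * g ⊥ := by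
    rw [← mean_const_mul, ← mean_const_mul, ← mean_sub, ← mean_sub,
      ← hμ.mean_const (f ⊥ * g ⊥), ← mean_add]
    congr 1; funext x; ring
  rw [e1, mean_sub, mean_sub, hμ.mean_const, hμ.mean_const] at key
  unfold cov
  linarith

/-- Covariances control the defect from multiplicativity of products of coordinates. -/
lemma Associated.abs_mean_prod_sub_le (ha : Associated μ) (hμ : IsPMF μ) {κ : Type*}
    (i : κ → ι) {δ : ℝ} (hδ : 0 ≤ δ) (s : Finset κ)
    (hc : ∀ a ∈ s, ∀ b ∈ s, a ≠ b → cov μ (bit (i a)) (bit (i b)) ≤ δ) :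
    |mean μ (fun x => ∏ r ∈ s, bit (i r) x) - ∏ r ∈ s, mean μ (bit (i r))| ≤
      (#s : ℝ) ^ 2 * δ := by
  classical
  induction s using Finset.induction_on with
  | empty => simp [hμ.mean_const]
  | insert a s has ih =>
    have ih' := ih fun b hb c hc' => hc b (mem_insert_of_mem hb) c (mem_insert_of_mem hc')
    have hprod_mono : Monotone fun x => ∏ r ∈ s, bit (i r) x := fun x y hxy =>
      prod_le_prod (fun r _ => bit_nonneg _ _) fun r _ => bit_mono _ hxy
    have hdiff_mono : Monotone fun x => ∑ r ∈ s, bit (i r) x - ∏ r ∈ s, bit (i r) x := by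
      intro x y hxy
      dsimp only
      by_cases hy : ∏ r ∈ s, bit (i r) x = ∏ r ∈ s, bit (i r) y
      · rw [hy]
        exact sub_le_sub_right (sum_le_sum fun r _ => bit_mono _ hxy) _
      · obtain ⟨r, hr, hne⟩ : ∃ r ∈ s, bit (i r) x ≠ bit (i r) y := by
          by_contra hcon
          push Not at hcon
          exact hy (prod_congr rfl hcon)
        have h0 : bit (i r) x = 0 ∧ bit (i r) y = 1 := by
          have := bit_mono (i r) hxy
          revert hne this
          unfold bit
          split_ifs <;> norm_num
        have h1 : ∏ r ∈ s, bit (i r) x = 0 := prod_eq_zero hr h0.1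
        have h2 : ∏ r ∈ s, bit (i r) y ≤ 1 :=
          prod_le_one (fun r _ => bit_nonneg _ _) fun r _ => bit_le_one _ _
        have h3 : bit (i r) y - bit (i r) x ≤ ∑ r ∈ s, (bit (i r) y - bit (i r) x) :=
          single_le_sum (f := fun r => bit (i r) y - bit (i r) x)
            (fun r _ => sub_nonneg.2 (bit_mono _ hxy)) hr
        rw [sum_sub_distrib] at h3
        linarith [h0.1, h0.2]
    have c1 := ha _ _ (bit_mono (i a)) hprod_mono
    have c2 := ha _ _ hdiff_mono (bit_mono (i a))
    rw [cov_sub_left, cov_sum_left, cov_comm (fun x => ∏ r ∈ s, bit (i r) x)] at c2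
    have c3 : ∑ r ∈ s, cov μ (bit (i r)) (bit (i a)) ≤ #s * δ := by
      rw [← nsmul_eq_mul]
      refine sum_le_card_nsmul _ _ _ fun r hr => ?_
      exact hc r (mem_insert_of_mem hr) a (mem_insert_self _ _) (by rintro rfl; exact has hr)
    have e1 : mean μ (fun x => ∏ r ∈ insert a s, bit (i r) x) =
        mean μ (fun x => bit (i a) x * ∏ r ∈ s, bit (i r) x) := by
      congr 1; funext x; rw [prod_insert has]
    rw [e1, prod_insert has, card_insert_of_notMem has]
    have c4 : |cov μ (bit (i a)) (fun x => ∏ r ∈ s, bit (i r) x)| ≤ #s * δ := by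
      rw [abs_of_nonneg c1]; linarith
    have m0 := hμ.mean_nonneg (bit_nonneg (i a))
    have m1 := hμ.mean_le (bit_le_one (i a))
    calc _ = |cov μ (bit (i a)) (fun x => ∏ r ∈ s, bit (i r) x) + mean μ (bit (i a)) *
              (mean μ (fun x => ∏ r ∈ s, bit (i r) x) - ∏ r ∈ s, mean μ (bit (i r)))| := by
          unfold cov; congr 1; ring
      _ ≤ #s * δ + 1 * ((#s : ℝ) ^ 2 * δ) := by
          refine (abs_add_le _ _).trans (add_le_add c4 ?_)
          rw [abs_mul, abs_of_nonneg m0]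
          exact mul_le_mul m1 ih' (abs_nonneg _) zero_le_one
      _ ≤ _ := by
          push_cast
          nlinarith [mul_nonneg (Nat.cast_nonneg (α := ℝ) #s) hδ]

/-- A function which is monotone on a set agrees there with a monotone function. -/
lemma exists_monotone_eqOn (h : (ι → Bool) → ℝ) (P : (ι → Bool) → Prop) {B : ℝ}
    (hB : ∀ x, |h x| ≤ B) (hP : ∀ x y, P x → P y → y ≤ x → h y ≤ h x) :
    ∃ K : (ι → Bool) → ℝ, Monotone K ∧ (∀ x, |K x| ≤ B) ∧ ∀ x, P x → K x = h x := by
  classical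
  have hne : ∀ x : ι → Bool, (univ.filter fun y => y ≤ x).Nonempty := fun x =>
    ⟨x, by simp⟩
  let u : (ι → Bool) → ℝ := fun y => if P y then h y else -B
  have hu : ∀ y, -B ≤ u y ∧ u y ≤ B := by
    intro y
    have := abs_le.1 (hB y)
    simp only [u]
    split_ifs
    · exact this
    · exact ⟨le_rfl, by linarith⟩
  refine ⟨fun x => (univ.filter fun y => y ≤ x).sup' (hne x) u, fun x y hxy => ?_,
    fun x => abs_le.2 ⟨?_, ?_⟩, fun x hx => le_antisymm ?_ ?_⟩
  · exact sup'_mono u (fun z hz => by simp only [mem_filter_univ] at hz ⊢; exact hz.trans hxy) _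
  · exact (hu x).1.trans (le_sup' u (by simp))
  · exact sup'_le _ _ fun y _ => (hu y).2
  · refine sup'_le _ _ fun y hy => ?_
    simp only [mem_filter_univ] at hy
    simp only [u]
    split_ifs with hPy
    · exact hP x y hx hPy hy
    · exact (abs_le.1 (hB x)).1
  · refine le_trans ?_ (le_sup' u (by simp : x ∈ univ.filter fun y => y ≤ x))
    simp only [u, if_pos hx, le_refl]

end Cube

/-! ### Gibbs weights of multilinear energies with nonnegative coefficients -/

lemma Phi_pos (u : ℝ) : 0 < Phi u := by unfold Phi; positivity

lemma Phi_lt_one (u : ℝ) : Phi u < 1 := by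
  unfold Phi
  rw [div_lt_one (by positivity)]
  linarith

lemma hasDerivAt_Phi (u : ℝ) : HasDerivAt Phi (Phi u * (1 - Phi u)) u := by
  have hne : 1 + Real.exp u ≠ 0 := by positivity
  have heq : Phi u * (1 - Phi u) =
      (Real.exp u * (1 + Real.exp u) - Real.exp u * Real.exp u) / (1 + Real.exp u) ^ 2 := by
    unfold Phi
    field_simp
  rw [heq]
  exact (Real.hasDerivAt_exp u).div ((Real.hasDerivAt_exp u).const_add 1) hne

lemma differentiable_Phi : Differentiable ℝ Phi := fun u => (hasDerivAt_Phi u).differentiableAt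

lemma continuous_Phi : Continuous Phi := differentiable_Phi.continuous

lemma Phi_strictMono : StrictMono Phi :=
  strictMono_of_deriv_pos fun u => by
    rw [(hasDerivAt_Phi u).deriv]
    exact mul_pos (Phi_pos u) (sub_pos.2 (Phi_lt_one u))

section Gibbs

variable {ι J : Type*} [DecidableEq ι] [Fintype J]

/-- The multilinear energy with coefficient `w j` on the monomial indexed by `A j`. -/
noncomputable def energy (A : J → Finset ι) (w : J → ℝ) (x : ι → Bool) : ℝ :=
  ∑ j, w j * allInd (A j) x

/-- The discrete derivative of the energy in direction `e`. -/
noncomputable def energyDeriv (A : J → Finset ι) (w : J → ℝ) (e : ι) (x : ι → Bool) : ℝ :=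
  ∑ j, if e ∈ A j then w j * allInd ((A j).erase e) x else 0

/-- The sum over `f` of the mixed second discrete derivatives of the energy in directions
`e` and `f`. -/
noncomputable def energyDeriv₂ (A : J → Finset ι) (w : J → ℝ) (e : ι) (x : ι → Bool) : ℝ :=
  ∑ j, if e ∈ A j then w j * ∑ f ∈ (A j).erase e, allInd (((A j).erase e).erase f) x else 0

/-- Total coefficient of the monomials containing both `e` and `f`. -/
noncomputable def pairWeight (A : J → Finset ι) (w : J → ℝ) (e f : ι) : ℝ :=
  ∑ j, if e ∈ A j ∧ f ∈ A j then w j else 0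

variable {A : J → Finset ι} {w : J → ℝ}

lemma energy_sub_update (e : ι) (x : ι → Bool) :
    energy A w (Function.update x e true) - energy A w (Function.update x e false) =
      energyDeriv A w e x := by
  simp only [energy, energyDeriv, ← sum_sub_distrib, ← mul_sub, allInd_sub_update, mul_ite,
    mul_zero]

lemma energyDeriv_update (e : ι) (x : ι → Bool) (b : Bool) :
    energyDeriv A w e (Function.update x e b) = energyDeriv A w e x := by
  simp only [energyDeriv, allInd_update_of_notMem (notMem_erase e _)]

lemma pairWeight_nonneg (hw : ∀ j, 0 ≤ w j) (e f : ι) : 0 ≤ pairWeight A w e f :=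
  sum_nonneg fun j _ => by split_ifs <;> simp [hw j]

lemma energyDeriv_step (hw : ∀ j, 0 ≤ w j) (e f : ι) (x : ι → Bool) :
    0 ≤ energyDeriv A w e (Function.update x f true) -
        energyDeriv A w e (Function.update x f false) ∧
      energyDeriv A w e (Function.update x f true) -
        energyDeriv A w e (Function.update x f false) ≤
          if f = e then 0 else pairWeight A w e f := by
  by_cases hfe : f = e
  · subst hfe
    simp [energyDeriv_update]
  · have key : energyDeriv A w e (Function.update x f true) -
        energyDeriv A w e (Function.update x f false) =
        ∑ j, if e ∈ A j ∧ f ∈ A j then w j * allInd (((A j).erase e).erase f) x else 0 := by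
      rw [energyDeriv, energyDeriv, ← sum_sub_distrib]
      refine sum_congr rfl fun j _ => ?_
      by_cases he : e ∈ A j
      · rw [if_pos he, if_pos he, ← mul_sub, allInd_sub_update]
        simp [he, hfe]
      · simp [he]
    rw [key, if_neg hfe]
    refine ⟨sum_nonneg fun j _ => ?_, sum_le_sum fun j _ => ?_⟩
    · split_ifs
      exacts [mul_nonneg (hw j) (allInd_nonneg _ _), le_rfl]
    · split_ifs
      exacts [mul_le_of_le_one_right (hw j) (allInd_le_one _ _), le_rfl]

lemma energyDeriv₂_step (hw : ∀ j, 0 ≤ w j) {d : ℕ} (hd : ∀ j, #(A j) ≤ d) (e f : ι)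
    (x : ι → Bool) :
    0 ≤ energyDeriv₂ A w e (Function.update x f true) -
        energyDeriv₂ A w e (Function.update x f false) ∧
      energyDeriv₂ A w e (Function.update x f true) -
        energyDeriv₂ A w e (Function.update x f false) ≤
          d * if f = e then 0 else pairWeight A w e f := by
  have key : energyDeriv₂ A w e (Function.update x f true) -
      energyDeriv₂ A w e (Function.update x f false) =
      ∑ j, if e ∈ A j then w j * ∑ g ∈ (A j).erase e,
        (if f ∈ ((A j).erase e).erase g then
          allInd ((((A j).erase e).erase g).erase f) x else 0) else 0 := by
    rw [energyDeriv₂, energyDeriv₂, ← sum_sub_distrib]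
    refine sum_congr rfl fun j _ => ?_
    by_cases he : e ∈ A j
    · simp only [if_pos he, ← mul_sub, ← sum_sub_distrib, allInd_sub_update]
    · simp [he]
  rw [key]
  have hnn : ∀ (j : J) (g : ι), 0 ≤ (if f ∈ ((A j).erase e).erase g then
          allInd ((((A j).erase e).erase g).erase f) x else 0) := fun j g => by
    split_ifs
    exacts [allInd_nonneg _ _, le_rfl]
  refine ⟨sum_nonneg fun j _ => ?_, ?_⟩
  · split_ifs
    exacts [mul_nonneg (hw j) (sum_nonneg fun g _ => hnn j g), le_rfl]
  · by_cases hfe : f = e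
    · subst hfe
      simp
    · rw [if_neg hfe, pairWeight, mul_sum]
      refine sum_le_sum fun j _ => ?_
      by_cases he : e ∈ A j
      · by_cases hf : f ∈ A j
        · rw [if_pos he, if_pos ⟨he, hf⟩, mul_comm (d : ℝ)]
          refine mul_le_mul_of_nonneg_left ?_ (hw j)
          calc _ ≤ ∑ g ∈ (A j).erase e, (1 : ℝ) := sum_le_sum fun g _ => by
                split_ifs
                exacts [allInd_le_one _ _, zero_le_one]
            _ ≤ d := by
                rw [sum_const, nsmul_one]
                exact_mod_cast (card_erase_le).trans (hd j)
        · simp [hf]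
      · simp [he]

variable [Fintype ι]

/-- The Gibbs weight of a multilinear energy. -/
noncomputable def gibbs (A : J → Finset ι) (w : J → ℝ) (x : ι → Bool) : ℝ :=
  Real.exp (energy A w x) / ∑ y, Real.exp (energy A w y)

lemma sum_exp_energy_pos : 0 < ∑ y : ι → Bool, Real.exp (energy A w y) :=
  sum_pos (fun _ _ => Real.exp_pos _) univ_nonempty

lemma isPMF_gibbs : IsPMF (gibbs A w) where
  nonneg x := div_nonneg (Real.exp_pos _).le sum_exp_energy_pos.le
  sum_eq := by
    simp only [gibbs]
    rw [← sum_div, div_self sum_exp_energy_pos.ne']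

lemma associated_gibbs (hw : ∀ j, 0 ≤ w j) : Associated (gibbs A w) := by
  refine isPMF_gibbs.associated_of_lattice fun x y => ?_
  simp only [gibbs]
  rw [div_mul_div_comm, div_mul_div_comm, ← Real.exp_add, ← Real.exp_add]
  refine div_le_div_of_nonneg_right (Real.exp_le_exp.2 ?_)
    (mul_self_nonneg (∑ y, Real.exp (energy A w y)))
  simp only [energy, ← sum_add_distrib, ← mul_add]
  exact sum_le_sum fun j _ => mul_le_mul_of_nonneg_left (allInd_supermodular _ _ _) (hw j)

/-- Conditionally on the other coordinates, the coordinate `e` is present with probability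
`Phi (energyDeriv A w e x)`. -/
lemma mean_gibbs_bit_mul (e : ι) (F : (ι → Bool) → ℝ)
    (hF : ∀ x b, F (Function.update x e b) = F x) :
    mean (gibbs A w) (fun x => bit e x * F x) =
      mean (gibbs A w) (fun x => Phi (energyDeriv A w e x) * F x) := by
  let t : (ι → Bool) → ℝ := fun x =>
    gibbs A w x * ((bit e x - Phi (energyDeriv A w e x)) * F x)
  have ht : ∀ x, t (Function.update x e true) + t (Function.update x e false) = 0 := by
    intro x
    have h1 : Real.exp (energy A w (Function.update x e true)) =
        Real.exp (energyDeriv A w e x) * Real.exp (energy A w (Function.update x e false)) := by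
      rw [← Real.exp_add, ← energy_sub_update]; congr 1; ring
    have hZ := (sum_exp_energy_pos (A := A) (w := w)).ne'
    have hp : 1 + Real.exp (energyDeriv A w e x) ≠ 0 := by positivity
    simp only [t, gibbs, hF, energyDeriv_update, h1, bit, Function.update_self, Phi]
    field_simp
    simp
  have hsum : ∑ x, t x = 0 := by
    refine sum_involution (fun x _ => Function.update x e (!x e)) (fun x _ => ?_)
      (fun x _ _ h => ?_) (fun _ _ => mem_univ _) (fun x _ => by simp)
    · have hx := Function.update_eq_self e x
      cases hxe : x e
      · rw [hxe] at hx
        have := ht x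
        rw [hx] at this
        rw [Bool.not_false]; linarith
      · rw [hxe] at hx
        have := ht x
        rw [hx] at this
        rw [Bool.not_true]; linarith
    · have := congrFun h e
      simp at this
  have h0 : mean (gibbs A w) (fun x => bit e x * F x - Phi (energyDeriv A w e x) * F x) = 0 := by
    rw [← hsum]
    exact sum_congr rfl fun x _ => by simp only [t]; ring
  rw [mean_sub] at h0
  linarith

end Gibbs

/-! ### Comparison with product measures -/

section Product

variable {ι : Type*} [DecidableEq ι]

/-- Resample the coordinate `e` of `f` with success probability `q`. -/
noncomputable def resample (q : ℝ) (e : ι) (f : (ι → Bool) → ℝ) (x : ι → Bool) : ℝ :=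
  q * f (Function.update x e true) + (1 - q) * f (Function.update x e false)

/-- Resample all coordinates in a list, independently with success probability `q`. -/
noncomputable def resampleList (q : ℝ) : List ι → ((ι → Bool) → ℝ) → (ι → Bool) → ℝ
  | [], f => f
  | e :: l, f => resampleList q l (resample q e f)

variable {q : ℝ}

lemma resampleList_mono (h0 : 0 ≤ q) (h1 : q ≤ 1) (l : List ι) {f g : (ι → Bool) → ℝ}
    (h : ∀ x, f x ≤ g x) (x : ι → Bool) : resampleList q l f x ≤ resampleList q l g x := by
  induction l generalizing f g with
  | nil => exact h x
  | cons e l ih =>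
    exact ih fun y => add_le_add (mul_le_mul_of_nonneg_left (h _) h0)
      (mul_le_mul_of_nonneg_left (h _) (sub_nonneg.2 h1))

lemma resampleList_const_mul (l : List ι) (c : ℝ) (f : (ι → Bool) → ℝ) :
    resampleList q l (fun x => c * f x) = fun x => c * resampleList q l f x := by
  induction l generalizing f with
  | nil => rfl
  | cons e l ih =>
    simp only [resampleList]
    rw [← ih]
    congr 1; funext x; simp only [resample]; ring

lemma resampleList_sum {κ : Type*} (l : List ι) (s : Finset κ) (f : κ → (ι → Bool) → ℝ) :
    resampleList q l (fun x => ∑ k ∈ s, f k x) = fun x => ∑ k ∈ s, resampleList q l (f k) x := by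
  induction l generalizing f with
  | nil => rfl
  | cons e l ih =>
    simp only [resampleList]
    rw [← ih]
    congr 1; funext x; simp only [resample, mul_sum, sum_add_distrib]

lemma resample_allInd (e : ι) (B : Finset ι) :
    resample q e (allInd B) = fun x => (if e ∈ B then q else 1) * allInd (B.erase e) x := by
  funext x
  unfold resample
  split_ifs with h
  · rw [allInd_update_true, allInd_update_false h]; ring
  · rw [allInd_update_of_notMem h, allInd_update_of_notMem h, erase_eq_of_notMem h]; ring

lemma resampleList_allInd (l : List ι) (B : Finset ι) (h : ∀ e ∈ B, e ∈ l) :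
    resampleList q l (allInd B) = fun _ => q ^ #B := by
  induction l generalizing B with
  | nil =>
    have : B = ∅ := eq_empty_of_forall_notMem fun e he => by simpa using h e he
    subst this
    funext x
    simp [resampleList, allInd]
  | cons e l ih =>
    rw [resampleList, resample_allInd, resampleList_const_mul, ih (B.erase e)]
    · funext x
      by_cases he : e ∈ B
      · rw [if_pos he, ← card_erase_add_one he, pow_succ']
      · rw [if_neg he, one_mul, erase_eq_of_notMem he]
    · intro f hf
      rw [mem_erase] at hf
      simpa [hf.1] using h f hf.2

lemma exp_le_add_exp_sq (t : ℝ) : Real.exp t ≤ t + Real.exp (t ^ 2) := by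
  have hsq := Real.add_one_le_exp (t ^ 2)
  rcases le_or_gt |t| 1 with h | h
  · have := (abs_le.1 (Real.abs_exp_sub_one_sub_id_le h)).2
    linarith
  · rcases lt_abs.1 h with h | h
    · have : Real.exp t ≤ Real.exp (t ^ 2) := Real.exp_le_exp.2 (by nlinarith)
      linarith
    · have : Real.exp t ≤ 1 := Real.exp_le_one_iff.2 (by linarith)
      nlinarith

lemma bernoulli_exp_le (h0 : 0 ≤ q) (h1 : q ≤ 1) (a b : ℝ) :
    q * Real.exp a + (1 - q) * Real.exp b ≤
      Real.exp (q * a + (1 - q) * b + (a - b) ^ 2) := by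
  have ha := exp_le_add_exp_sq ((1 - q) * (a - b))
  have hb := exp_le_add_exp_sq (-q * (a - b))
  have ha' : Real.exp (((1 - q) * (a - b)) ^ 2) ≤ Real.exp ((a - b) ^ 2) := by
    refine Real.exp_le_exp.2 ?_
    rw [mul_pow]
    exact mul_le_of_le_one_left (sq_nonneg _) (by nlinarith)
  have hb' : Real.exp ((-q * (a - b)) ^ 2) ≤ Real.exp ((a - b) ^ 2) := by
    refine Real.exp_le_exp.2 ?_
    rw [mul_pow]
    exact mul_le_of_le_one_left (sq_nonneg _) (by nlinarith)
  have hq : 0 ≤ 1 - q := sub_nonneg.2 h1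
  have key : q * Real.exp ((1 - q) * (a - b)) + (1 - q) * Real.exp (-q * (a - b)) ≤
      Real.exp ((a - b) ^ 2) := by
    have e1 := mul_le_mul_of_nonneg_left (ha.trans (add_le_add_right ha' _)) h0
    have e2 := mul_le_mul_of_nonneg_left (hb.trans (add_le_add_right hb' _)) hq
    linarith
  have e1 : Real.exp a = Real.exp (q * a + (1 - q) * b) * Real.exp ((1 - q) * (a - b)) := by
    rw [← Real.exp_add]; congr 1; ring
  have e2 : Real.exp b = Real.exp (q * a + (1 - q) * b) * Real.exp (-q * (a - b)) := by
    rw [← Real.exp_add]; congr 1; ring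
  rw [Real.exp_add _ ((a - b) ^ 2), e1, e2]
  have := mul_le_mul_of_nonneg_left key (Real.exp_pos (q * a + (1 - q) * b)).le
  linarith

lemma resample_step (e : ι) (F : (ι → Bool) → ℝ) (f : ι) (x : ι → Bool) :
    resample q e F (Function.update x f true) - resample q e F (Function.update x f false) =
      if f = e then 0 else
        q * (F (Function.update (Function.update x e true) f true) -
            F (Function.update (Function.update x e true) f false)) +
          (1 - q) * (F (Function.update (Function.update x e false) f true) -
            F (Function.update (Function.update x e false) f false)) := by
  split_ifs with h
  · subst h; simp [resample]
  · simp only [resample, Function.update_comm h]; ring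

lemma abs_resample_step_le (h0 : 0 ≤ q) (h1 : q ≤ 1) {F : (ι → Bool) → ℝ} {c : ι → ℝ}
    (hc : ∀ f x, |F (Function.update x f true) - F (Function.update x f false)| ≤ c f)
    (e f : ι) (x : ι → Bool) :
    |resample q e F (Function.update x f true) -
      resample q e F (Function.update x f false)| ≤ c f := by
  rw [resample_step]
  split_ifs
  · rw [abs_zero]; exact (abs_nonneg _).trans (hc f x)
  · have hq : 0 ≤ 1 - q := sub_nonneg.2 h1
    refine (abs_add_le _ _).trans ?_
    rw [abs_mul, abs_mul, abs_of_nonneg h0, abs_of_nonneg hq]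
    have e1 := mul_le_mul_of_nonneg_left (hc f (Function.update x e true)) h0
    have e2 := mul_le_mul_of_nonneg_left (hc f (Function.update x e false)) hq
    linarith

/-- Exponential moments of functions with bounded differences under product measures. -/
lemma resampleList_exp_le (h0 : 0 ≤ q) (h1 : q ≤ 1) (l : List ι) {F : (ι → Bool) → ℝ}
    {c : ι → ℝ} (hc : ∀ f x, |F (Function.update x f true) - F (Function.update x f false)| ≤ c f)
    (x : ι → Bool) :
    resampleList q l (fun y => Real.exp (F y)) x ≤
      Real.exp (resampleList q l F x + (l.map fun f => c f ^ 2).sum) := by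
  induction l generalizing F with
  | nil => simp [resampleList]
  | cons e l ih =>
    simp only [resampleList, List.map_cons, List.sum_cons]
    have hstep : ∀ y, resample q e (fun y => Real.exp (F y)) y ≤
        Real.exp (c e ^ 2) * Real.exp (resample q e F y) := fun y => by
      rw [← Real.exp_add]
      refine (bernoulli_exp_le h0 h1 _ _).trans (Real.exp_le_exp.2 ?_)
      rw [add_comm]
      exact add_le_add_left (sq_le_sq.2 ((hc e y).trans (le_abs_self _))) _
    refine (resampleList_mono h0 h1 l hstep x).trans ?_
    rw [resampleList_const_mul]
    refine (mul_le_mul_of_nonneg_left (ih (abs_resample_step_le h0 h1 hc e))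
      (Real.exp_pos _).le).trans ?_
    rw [← Real.exp_add]
    exact Real.exp_le_exp.2 (by linarith)

variable [Fintype ι]

/-- `g e` is the conditional probability under `μ` that the coordinate `e` is present given the
other coordinates. -/
structure IsCondProb (μ : (ι → Bool) → ℝ) (g : ι → (ι → Bool) → ℝ) : Prop where
  nonneg : ∀ e x, 0 ≤ g e x
  le_one : ∀ e x, g e x ≤ 1
  mean_bit_mul : ∀ e (F : (ι → Bool) → ℝ), (∀ x b, F (Function.update x e b) = F x) →
    mean μ (fun x => bit e x * F x) = mean μ (fun x => g e x * F x)

lemma isCondProb_gibbs {J : Type*} [Fintype J] (A : J → Finset ι) (w : J → ℝ) :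
    IsCondProb (gibbs A w) fun e x => Phi (energyDeriv A w e x) where
  nonneg _ _ := (Phi_pos _).le
  le_one _ _ := (Phi_lt_one _).le
  mean_bit_mul := mean_gibbs_bit_mul

/-- If the conditional probabilities `g e` of the coordinates under `μ` are on the correct side
of `q` outside events of small probability, then `μ` is nearly dominated by the product measure
with success probability `q`; the sign `s` selects the direction. -/
lemma mean_le_mean_resampleList {μ : (ι → Bool) → ℝ} (hμ : IsPMF μ)
    {g : ι → (ι → Bool) → ℝ} (hg : IsCondProb μ g)
    (h0 : 0 ≤ q) (h1 : q ≤ 1) {s : ℝ} (hs : s = 1 ∨ s = -1) (l : List ι)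
    {f : (ι → Bool) → ℝ} (hf : ∀ x, 0 ≤ f x ∧ f x ≤ 1)
    (hmono : ∀ e x, 0 ≤ s * (f (Function.update x e true) - f (Function.update x e false))) :
    mean μ f ≤ mean μ (resampleList q l f) +
      (l.map fun e => mean μ fun x => if 0 < s * (g e x - q) then 1 else 0).sum := by
  induction l generalizing f with
  | nil => simp [resampleList]
  | cons e l ih =>
    have hq : 0 ≤ 1 - q := sub_nonneg.2 h1
    have ih' := ih (f := resample q e f)
      (fun x => by
        have a := hf (Function.update x e true)
        have b := hf (Function.update x e false)
        unfold resample
        constructor <;> nlinarith)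
      (fun e' x => by
        rw [resample_step]
        split_ifs
        · simp
        · have a := mul_nonneg h0 (hmono e' (Function.update x e true))
          have b := mul_nonneg hq (hmono e' (Function.update x e false))
          linarith)
    simp only [List.map_cons, List.sum_cons, resampleList]
    have hstep : mean μ f - mean μ (resample q e f) ≤
        mean μ fun x => if 0 < s * (g e x - q) then 1 else 0 := by
      let Δ : (ι → Bool) → ℝ := fun x =>
        f (Function.update x e true) - f (Function.update x e false)
      have hΔ : ∀ x b, Δ (Function.update x e b) = Δ x := fun x b => by simp [Δ]
      have e1 : mean μ f - mean μ (resample q e f) = mean μ fun x => (g e x - q) * Δ x := by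
        simp only [sub_mul]
        rw [mean_sub (fun x => g e x * Δ x), ← hg.mean_bit_mul e Δ hΔ, ← mean_sub, ← mean_sub]
        congr 1; funext x
        have hx := Function.update_eq_self e x
        simp only [resample, Δ, bit]
        cases hxe : x e
        · rw [hxe] at hx
          simp only [hx]
          simp
          ring
        · rw [hxe] at hx
          simp only [hx]
          simp
          ring
      rw [e1]
      refine hμ.mean_mono fun x => ?_
      have a := hmono e x
      have b1 := hf (Function.update x e true)
      have b2 := hf (Function.update x e false)
      have c := And.intro (hg.nonneg e x) (hg.le_one e x)
      simp only [Δ]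
      split_ifs with h
      · rcases hs with rfl | rfl <;> nlinarith
      · rcases hs with rfl | rfl <;> nlinarith
    linarith

/-- Tail bound for functions with bounded differences, transferred from a product measure. -/
lemma mean_tail_le {μ : (ι → Bool) → ℝ} (hμ : IsPMF μ)
    {g : ι → (ι → Bool) → ℝ} (hg : IsCondProb μ g)
    (h0 : 0 ≤ q) (h1 : q ≤ 1) {s : ℝ} (hs : s = 1 ∨ s = -1)
    {F : (ι → Bool) → ℝ} {c : ι → ℝ}
    (hF : ∀ f x, 0 ≤ F (Function.update x f true) - F (Function.update x f false) ∧
      F (Function.update x f true) - F (Function.update x f false) ≤ c f)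
    {a ε v l : ℝ} (hv : ∑ f, c f ^ 2 ≤ v) (hl : 0 ≤ l)
    (hE : ∀ x, s * resampleList q univ.toList F x ≤ s * a) :
    mean μ (fun x => if ε < s * (F x - a) then 1 else 0) ≤
      Real.exp (l ^ 2 * v - l * ε) +
        ∑ e, mean μ fun x => if 0 < s * (g e x - q) then 1 else 0 := by
  have tr := mean_le_mean_resampleList hμ hg h0 h1 hs univ.toList
    (f := fun x => if ε < s * (F x - a) then 1 else 0)
    (fun x => by split_ifs <;> norm_num)
    (fun e x => by
      have hm := (hF e x).1
      rcases hs with rfl | rfl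
      · split_ifs <;> first | norm_num; done | (exfalso; linarith)
      · split_ifs <;> first | norm_num; done | (exfalso; linarith))
  rw [sum_map_toList] at tr
  refine tr.trans (add_le_add_left (hμ.mean_le fun x => ?_) _)
  have hpt : ∀ y, (if ε < s * (F y - a) then (1 : ℝ) else 0) ≤
      Real.exp (-l * s * a - l * ε) * Real.exp (l * s * F y) := fun y => by
    rw [← Real.exp_add]
    split_ifs with h
    · exact Real.one_le_exp (by nlinarith)
    · positivity
  refine (resampleList_mono h0 h1 _ hpt x).trans ?_
  rw [resampleList_const_mul]
  have hc : ∀ f y, |l * s * F (Function.update y f true) - l * s * F (Function.update y f false)| ≤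
      l * c f := fun f y => by
    rw [← mul_sub, mul_assoc, abs_mul, abs_mul, abs_of_nonneg hl, abs_of_nonneg (hF f y).1]
    have : |s| = 1 := by rcases hs with rfl | rfl <;> norm_num
    rw [this, one_mul]
    exact mul_le_mul_of_nonneg_left (hF f y).2 hl
  refine (mul_le_mul_of_nonneg_left (resampleList_exp_le h0 h1 _ hc x) (Real.exp_pos _).le).trans ?_
  rw [← Real.exp_add, resampleList_const_mul, sum_map_toList]
  refine Real.exp_le_exp.2 ?_
  have e1 : ∑ f, (l * c f) ^ 2 ≤ l ^ 2 * v := by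
    simp only [mul_pow, ← mul_sum]
    exact mul_le_mul_of_nonneg_left hv (sq_nonneg l)
  have e2 := mul_le_mul_of_nonneg_left (hE x) hl
  dsimp only
  linarith

end Product

/-! ### Variance of the number of present coordinates -/

section Variance

variable {ι : Type*} [DecidableEq ι] [Fintype ι]

lemma IsPMF.abs_mean_le {μ : (ι → Bool) → ℝ} (hμ : IsPMF μ) (f : (ι → Bool) → ℝ) :
    |mean μ f| ≤ mean μ fun x => |f x| :=
  (abs_sum_le_sum_abs _ _).trans (sum_le_sum fun x _ => by
    rw [abs_mul, abs_of_nonneg (hμ.nonneg x)])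

lemma IsPMF.abs_cov_le {μ : (ι → Bool) → ℝ} (hμ : IsPMF μ) (f g : (ι → Bool) → ℝ) {a : ℝ}
    (hg : ∀ x, |g x| ≤ a) : |cov μ f g| ≤ 2 * a * mean μ fun x => |f x| := by
  have h1 : |mean μ fun x => f x * g x| ≤ a * mean μ fun x => |f x| := by
    refine (hμ.abs_mean_le _).trans ?_
    rw [← mean_const_mul]
    refine hμ.mean_mono fun x => ?_
    rw [abs_mul, mul_comm]
    exact mul_le_mul_of_nonneg_right (hg x) (abs_nonneg _)
  have h2 : |mean μ f * mean μ g| ≤ a * mean μ fun x => |f x| := by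
    rw [abs_mul, mul_comm]
    exact mul_le_mul ((hμ.abs_mean_le g).trans (hμ.mean_le hg)) (hμ.abs_mean_le f)
      (abs_nonneg _) ((abs_nonneg _).trans (hg fun _ => true))
  unfold cov
  refine (abs_sub _ _).trans ?_
  linarith

variable {J : Type*} [Fintype J] {A : J → Finset ι} {w : J → ℝ}

lemma sum_energyDeriv_sub_le (hw : ∀ j, 0 ≤ w j) {x y : ι → Bool} (h : y ≤ x) {τ : ℝ}
    (hT : ∀ e, energyDeriv₂ A w e x ≤ τ) :
    ∑ e, energyDeriv A w e x - ∑ e, energyDeriv A w e y ≤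
      τ * (∑ e, bit e x - ∑ e, bit e y) := by
  have key : ∑ e, energyDeriv A w e x - ∑ e, energyDeriv A w e y ≤
      ∑ f, (bit f x - bit f y) * energyDeriv₂ A w f x := by
    have e1 : ∀ z, ∑ e, energyDeriv A w e z = ∑ j, w j * ∑ e ∈ A j, allInd ((A j).erase e) z := by
      intro z
      simp only [energyDeriv]
      rw [sum_comm]
      refine sum_congr rfl fun j _ => ?_
      rw [mul_sum, ← sum_filter]
      exact sum_congr (by ext; simp) fun _ _ => rfl
    have e2 : ∑ f, (bit f x - bit f y) * energyDeriv₂ A w f x =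
        ∑ j, w j * ∑ f ∈ A j, ∑ e ∈ (A j).erase f,
          (bit f x - bit f y) * allInd (((A j).erase f).erase e) x := by
      simp only [energyDeriv₂, mul_sum]
      rw [sum_comm]
      refine sum_congr rfl fun j _ => ?_
      simp only [mul_ite, mul_zero]
      rw [← sum_filter]
      refine sum_congr (by ext; simp) fun f _ => ?_
      rw [mul_sum]
      exact sum_congr rfl fun e _ => by ring
    rw [e1, e1, e2, ← sum_sub_distrib]
    refine sum_le_sum fun j _ => ?_
    rw [← mul_sub, ← sum_sub_distrib]
    refine mul_le_mul_of_nonneg_left ?_ (hw j)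
    calc _ ≤ ∑ e ∈ A j, ∑ f ∈ (A j).erase e,
          (bit f x - bit f y) * allInd (((A j).erase e).erase f) x :=
          sum_le_sum fun e _ => allInd_sub_le _ h
      _ = _ := by
          rw [sum_comm' (t' := A j) (s' := fun f => (A j).erase f)]
          · exact sum_congr rfl fun f _ => sum_congr rfl fun e _ => by rw [erase_right_comm]
          · intro e f
            simp only [mem_erase]
            tauto
  refine key.trans ?_
  rw [← sum_sub_distrib, mul_sum]
  refine sum_le_sum fun f _ => ?_
  rw [mul_comm]
  exact mul_le_mul_of_nonneg_right (hT f) (sub_nonneg.2 (bit_mono f h))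

/-- If, outside an unlikely event, the conditional probabilities vary slowly enough with the
configuration, the variance of the number of present coordinates is at most of the order of the
number of coordinates. -/
lemma variance_gibbs_le (hw : ∀ j, 0 ≤ w j) (P : (ι → Bool) → Prop) [DecidablePred P]
    {lo hi κ τ : ℝ}
    (hlo : ∀ x, P x → ∀ e, lo ≤ energyDeriv A w e x)
    (hhi : ∀ x, P x → ∀ e, energyDeriv A w e x ≤ hi)
    (hT : ∀ x, P x → ∀ e, energyDeriv₂ A w e x ≤ τ)
    (hΦ : ∀ u v, lo ≤ u → u ≤ v → v ≤ hi → Phi v - Phi u ≤ κ * (v - u))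
    (hκ : 0 ≤ κ) (hτ : 0 ≤ τ) (hκτ : κ * τ ≤ 1) :
    (1 - κ * τ) * cov (gibbs A w) (fun x => ∑ e, bit e x) (fun x => ∑ e, bit e x) ≤
      Fintype.card ι +
        4 * (Fintype.card ι : ℝ) ^ 2 * mean (gibbs A w) (fun x => if P x then 0 else 1) := by
  set μ := gibbs A w with hμdef
  have hμ : IsPMF μ := isPMF_gibbs
  have ha : Associated μ := associated_gibbs hw
  set M : ℝ := (Fintype.card ι : ℝ) with hM
  have hM0 : 0 ≤ M := Nat.cast_nonneg _
  let S : (ι → Bool) → ℝ := fun x => ∑ e, bit e x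
  let g : ι → (ι → Bool) → ℝ := fun e x => Phi (energyDeriv A w e x)
  let Θ : (ι → Bool) → ℝ := fun x => ∑ e, g e x
  have hg : IsCondProb μ g := isCondProb_gibbs A w
  have hSm : Monotone S := fun x y h => sum_le_sum fun e _ => bit_mono e h
  have hS0 : ∀ x, 0 ≤ S x := fun x => sum_nonneg fun e _ => bit_nonneg e x
  have hSM : ∀ x, S x ≤ M := fun x =>
    (sum_le_sum fun e _ => bit_le_one e x).trans (by simp [hM])
  have hΘ0 : ∀ x, 0 ≤ Θ x := fun x => sum_nonneg fun e _ => hg.nonneg e x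
  have hΘM : ∀ x, Θ x ≤ M := fun x =>
    (sum_le_sum fun e _ => hg.le_one e x).trans (by simp [hM])
  obtain ⟨K, hKm, hKB, hK⟩ := exists_monotone_eqOn (fun x => κ * τ * S x - Θ x) P (B := M)
    (fun x => by
      have h1 := mul_nonneg (mul_nonneg hκ hτ) (hS0 x)
      have h2 := mul_le_mul_of_nonneg_right hκτ (hS0 x)
      exact abs_le.2 ⟨by linarith [hΘM x], by linarith [hΘ0 x, hSM x]⟩)
    (fun x y hx hy hyx => by
      have h1 : Θ x - Θ y ≤ κ * (∑ e, energyDeriv A w e x - ∑ e, energyDeriv A w e y) := by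
        simp only [Θ, g, ← sum_sub_distrib, mul_sum]
        refine sum_le_sum fun e _ => hΦ _ _ (hlo y hy e) ?_ (hhi x hx e)
        refine sum_le_sum fun j _ => ?_
        split_ifs
        · exact mul_le_mul_of_nonneg_left (allInd_mono _ hyx) (hw j)
        · exact le_rfl
      have h2 := mul_le_mul_of_nonneg_left (sum_energyDeriv_sub_le hw hyx (hT x hx)) hκ
      simp only [S]
      linarith)
  have hcov : cov μ Θ S ≤ κ * τ * cov μ S S +
      4 * M ^ 2 * mean μ (fun x => if P x then 0 else 1) := by
    have h1 := ha K S hKm hSm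
    have h2 : cov μ (fun x => (κ * τ * S x - Θ x) - K x) S =
        κ * τ * cov μ S S - cov μ Θ S - cov μ K S := by
      rw [cov_sub_left, cov_sub_left, cov_const_mul_left]
    have h3 := hμ.abs_cov_le (fun x => (κ * τ * S x - Θ x) - K x) S (a := M)
      (fun x => abs_le.2 ⟨by linarith [hS0 x], hSM x⟩)
    have h4 : mean μ (fun x => |(κ * τ * S x - Θ x) - K x|) ≤
        2 * M * mean μ (fun x => if P x then 0 else 1) := by
      rw [← mean_const_mul]
      refine hμ.mean_mono fun x => ?_
      split_ifs with hx
      · rw [hK x hx]; simp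
      · have hs1 := mul_nonneg (mul_nonneg hκ hτ) (hS0 x)
        have hs2 := mul_le_mul_of_nonneg_right hκτ (hS0 x)
        have hk := abs_le.1 (hKB x)
        exact abs_le.2 ⟨by linarith [hΘM x], by linarith [hΘ0 x, hSM x]⟩
    have h5 := mul_le_mul_of_nonneg_left h4 (by positivity : 0 ≤ 2 * M)
    have h6 := neg_abs_le (cov μ (fun x => (κ * τ * S x - Θ x) - K x) S)
    nlinarith
  have hdiag : ∀ e, cov μ (bit e) S - cov μ (g e) S ≤ 1 := by
    intro e
    have h1 := hg.mean_bit_mul e (fun _ => 1) fun _ _ => rfl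
    simp only [mul_one] at h1
    have h2 := hg.mean_bit_mul e (fun x => ∑ f ∈ univ.erase e, bit f x) (fun x b =>
      sum_congr rfl fun f hf => by
        unfold bit; rw [Function.update_of_ne (ne_of_mem_erase hf)])
    have hsplit : ∀ x, S x = bit e x + ∑ f ∈ univ.erase e, bit f x := fun x =>
      (add_sum_erase _ _ (mem_univ e)).symm
    have h3 : ∀ k : (ι → Bool) → ℝ, mean μ (fun x => k x * S x) =
        mean μ (fun x => k x * bit e x) +
          mean μ (fun x => k x * ∑ f ∈ univ.erase e, bit f x) := fun k => by
      rw [← mean_add]; congr 1; funext x; rw [hsplit, mul_add]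
    have h4 : cov μ (bit e) S - cov μ (g e) S =
        mean μ (fun x => bit e x * bit e x) - mean μ (fun x => g e x * bit e x) := by
      unfold cov
      rw [h3, h3, h2, show mean μ (bit e) = mean μ (g e) from h1]
      ring
    rw [h4]
    have h5 : mean μ (fun x => bit e x * bit e x) ≤ 1 := hμ.mean_le fun x =>
      mul_le_one₀ (bit_le_one e x) (bit_nonneg e x) (bit_le_one e x)
    have h6 : 0 ≤ mean μ (fun x => g e x * bit e x) := hμ.mean_nonneg fun x =>
      mul_nonneg (hg.nonneg e x) (bit_nonneg e x)
    linarith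
  have hvar : cov μ S S ≤ M + cov μ Θ S := by
    have h1 : cov μ S S = ∑ e, cov μ (bit e) S := cov_sum_left _ _ _
    have h2 : cov μ Θ S = ∑ e, cov μ (g e) S := cov_sum_left _ _ _
    have h3 : ∑ e : ι, (cov μ (bit e) S - cov μ (g e) S) ≤ M :=
      (sum_le_sum fun e _ => hdiag e).trans (by simp [hM])
    rw [sum_sub_distrib] at h3
    linarith
  change (1 - κ * τ) * cov μ S S ≤ _
  linarith

end Variance

/-! ### Copies of a graph in the complete graph -/

section Copies

variable {n m : ℕ}

/-- The permutation of edges induced by a permutation of vertices. -/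
def edgePerm (σ : Equiv.Perm (Fin n)) : Equiv.Perm (EdgeSet n) where
  toFun e := ⟨e.1.map σ, (Sym2.isDiag_map σ.injective).not.2 e.2⟩
  invFun e := ⟨e.1.map σ.symm, (Sym2.isDiag_map σ.symm.injective).not.2 e.2⟩
  left_inv e := Subtype.ext (by simp [Sym2.map_map])
  right_inv e := Subtype.ext (by simp [Sym2.map_map])

lemma edgePerm_val (σ : Equiv.Perm (Fin n)) (e : EdgeSet n) : (edgePerm σ e).1 = e.1.map σ := rfl

lemma exists_eq_mk (e : EdgeSet n) : ∃ a b, a ≠ b ∧ e.1 = s(a, b) := by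
  obtain ⟨z, hz⟩ := e
  induction z with
  | _ a b => exact ⟨a, b, fun h => hz (by simpa using h), rfl⟩

lemma exists_edgePerm_eq (e f : EdgeSet n) : ∃ σ, edgePerm σ e = f := by
  obtain ⟨a, b, hab, he⟩ := exists_eq_mk e
  obtain ⟨c, d, hcd, hf⟩ := exists_eq_mk f
  obtain ⟨σ, hσ⟩ := Equiv.Perm.exists_extending_pair ![a, b] ![c, d]
    (by intro i j; fin_cases i <;> fin_cases j <;> simp [hab, hab.symm])
    (by intro i j; fin_cases i <;> fin_cases j <;> simp [hcd, hcd.symm])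
  refine ⟨σ, Subtype.ext ?_⟩
  have h0 : σ a = c := by simpa using hσ 0
  have h1 : σ b = d := by simpa using hσ 1
  rw [edgePerm_val, he, hf, Sym2.map_mk, h0, h1]

/-- A nonnegative function of pairs of edges which is invariant under vertex permutations is
small off the diagonal compared to its row sums. -/
lemma sub_four_mul_le_sum (c : EdgeSet n → EdgeSet n → ℝ) (hc : ∀ e f, 0 ≤ c e f)
    (hinv : ∀ σ e f, c (edgePerm σ e) (edgePerm σ f) = c e f) {e f : EdgeSet n} (hef : e ≠ f) :
    ((n : ℝ) - 4) * c e f ≤ ∑ f' ∈ univ.erase e, c e f' := by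
  obtain ⟨a, b, hab, he⟩ := exists_eq_mk e
  obtain ⟨v, u, hv, huv, hf⟩ : ∃ v u, v ∉ e.1 ∧ v ≠ u ∧ f.1 = s(v, u) := by
    obtain ⟨v, u, huv, hf⟩ := exists_eq_mk f
    by_cases h1 : v ∈ e.1
    · by_cases h2 : u ∈ e.1
      · exact absurd (Subtype.ext ((((Sym2.mem_and_mem_iff huv).1 ⟨h1, h2⟩)).trans hf.symm)) hef
      · exact ⟨u, v, h2, huv.symm, hf.trans Sym2.eq_swap⟩
    · exact ⟨v, u, h1, huv, hf⟩
  have hva : v ≠ a := by rintro rfl; exact hv (by rw [he]; simp)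
  have hvb : v ≠ b := by rintro rfl; exact hv (by rw [he]; simp)
  let W : Finset (Fin n) := univ \ {a, b, v, u}
  have hW : ∀ t ∈ W, t ≠ a ∧ t ≠ b ∧ t ≠ v ∧ t ≠ u := fun t ht => by
    simpa [W, not_or] using ht
  have hcard : (n : ℝ) - 4 ≤ #W := by
    have h1 := le_card_sdiff ({a, b, v, u} : Finset (Fin n)) univ
    have h2 : #({a, b, v, u} : Finset (Fin n)) ≤ 4 := card_le_four
    rw [card_univ, Fintype.card_fin] at h1
    have h3 : n ≤ #W + 4 := by simp only [W]; omega
    have : (n : ℝ) ≤ #W + 4 := by exact_mod_cast h3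
    linarith
  let φ : Fin n → EdgeSet n := fun t => edgePerm (Equiv.swap v t) f
  have hφ : ∀ t ∈ W, (φ t).1 = s(t, u) := fun t ht => by
    rw [edgePerm_val, hf, Sym2.map_mk, Equiv.swap_apply_left,
      Equiv.swap_apply_of_ne_of_ne huv.symm (hW t ht).2.2.2.symm]
  have hinj : Set.InjOn φ W := fun t ht t' ht' h => by
    have h1 := congrArg Subtype.val h
    rw [hφ t ht, hφ t' ht'] at h1
    have h2 : t = t' ∨ t = u ∧ u = t' := by simpa using h1
    exact h2.resolve_right fun h3 => (hW t ht).2.2.2 h3.1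
  have hval : ∀ t ∈ W, c e (φ t) = c e f := fun t ht => by
    have h1 : edgePerm (Equiv.swap v t) e = e := Subtype.ext (by
      rw [edgePerm_val, he, Sym2.map_mk,
        Equiv.swap_apply_of_ne_of_ne hva.symm (hW t ht).1.symm,
        Equiv.swap_apply_of_ne_of_ne hvb.symm (hW t ht).2.1.symm])
    have h2 := hinv (Equiv.swap v t) e f
    rwa [h1] at h2
  calc ((n : ℝ) - 4) * c e f ≤ #W * c e f := mul_le_mul_of_nonneg_right hcard (hc e f)
    _ = ∑ t ∈ W, c e (φ t) := by rw [sum_congr rfl hval, sum_const, nsmul_eq_mul]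
    _ = ∑ f' ∈ W.image φ, c e f' := (sum_image hinj).symm
    _ ≤ _ := by
      refine sum_le_sum_of_subset_of_nonneg (fun f' hf' => ?_) fun f' _ _ => hc e f'
      obtain ⟨t, ht, rfl⟩ := mem_image.1 hf'
      refine mem_erase.2 ⟨fun h => ?_, mem_univ _⟩
      have h1 := congrArg Subtype.val h
      rw [hφ t ht, he] at h1
      have h2 : t ∈ s(a, b) := by rw [← h1]; simp
      have := hW t ht
      simp only [Sym2.mem_iff] at h2
      tauto

open scoped Classical in
/-- The edges of the copy of `G` in the complete graph given by an embedding of the vertices. -/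
noncomputable def copyEdges (G : SimpleGraph (Fin m)) (ψ : Fin m ↪ Fin n) : Finset (EdgeSet n) :=
  univ.filter fun e => ∃ a b, G.Adj a b ∧ e.1 = s(ψ a, ψ b)

lemma mem_copyEdges {G : SimpleGraph (Fin m)} {ψ : Fin m ↪ Fin n} {e : EdgeSet n} :
    e ∈ copyEdges G ψ ↔ ∃ a b, G.Adj a b ∧ e.1 = s(ψ a, ψ b) := by
  simp [copyEdges]

lemma edgeInd_eq_bit {i j : Fin n} {e : EdgeSet n} (h : e.1 = s(i, j)) (x : Config n) :
    edgeInd x i j = bit e x := by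
  have hd : ¬ (s(i, j) : Sym2 (Fin n)).IsDiag := h ▸ e.2
  have he : (⟨s(i, j), hd⟩ : EdgeSet n) = e := Subtype.ext h.symm
  simp only [edgeInd, edgeVal, dif_neg hd, bit, he]

lemma NG_eq_sum_allInd (G : SimpleGraph (Fin m)) (x : Config n) :
    NG G x = ∑ ψ : Fin m ↪ Fin n, allInd (copyEdges G ψ) x := by
  classical
  unfold NG
  refine sum_congr rfl fun ψ _ => ?_
  have hedge : ∀ a b, G.Adj a b → ∃ e : EdgeSet n, e.1 = s(ψ a, ψ b) ∧ e ∈ copyEdges G ψ := by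
    intro a b hab
    have hd : ¬ (s(ψ a, ψ b) : Sym2 (Fin n)).IsDiag := by
      simpa using hab.ne
    exact ⟨⟨_, hd⟩, rfl, mem_copyEdges.2 ⟨a, b, hab, rfl⟩⟩
  by_cases h : ∀ e ∈ copyEdges G ψ, x e = true
  · rw [allInd, if_pos h]
    refine prod_eq_one fun a _ => prod_eq_one fun b _ => ?_
    split_ifs with hab
    · obtain ⟨e, he, hmem⟩ := hedge a b hab
      rw [edgeInd_eq_bit he, bit, if_pos (h e hmem)]
    · rfl
  · rw [allInd, if_neg h]
    push Not at h
    obtain ⟨e, hmem, hx⟩ := h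
    obtain ⟨a, b, hab, he⟩ := mem_copyEdges.1 hmem
    refine prod_eq_zero (mem_univ a) (prod_eq_zero (mem_univ b) ?_)
    rw [if_pos hab, edgeInd_eq_bit he, bit, if_neg hx]

lemma card_copyEdges (G : SimpleGraph (Fin m)) (ψ : Fin m ↪ Fin n) :
    #(copyEdges G ψ) = numEdges G := by
  rw [numEdges, ← Set.ncard_image_of_injective G.edgeSet (Sym2.map.injective ψ.injective),
    ← card_map (Function.Embedding.subtype _), ← Set.ncard_coe_finset]
  congr 1
  ext z
  simp only [coe_map, Set.mem_image, mem_coe, Function.Embedding.subtype_apply, mem_copyEdges]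
  constructor
  · rintro ⟨e, ⟨a, b, hab, he⟩, rfl⟩
    exact ⟨s(a, b), hab, he.symm⟩
  · rintro ⟨y, hy, rfl⟩
    induction y with
    | _ a b =>
      have hab : G.Adj a b := hy
      exact ⟨⟨s(ψ a, ψ b), by simpa using hab.ne⟩, ⟨a, b, hab, rfl⟩, rfl⟩

/-- The embeddings of a vertex set, permuted by a permutation of the target. -/
def embeddingPerm (m : ℕ) (σ : Equiv.Perm (Fin n)) : Equiv.Perm (Fin m ↪ Fin n) where
  toFun ψ := ψ.trans σ.toEmbedding
  invFun ψ := ψ.trans σ.symm.toEmbedding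
  left_inv ψ := by ext; simp
  right_inv ψ := by ext; simp

lemma edgePerm_mem_copyEdges (G : SimpleGraph (Fin m)) (ψ : Fin m ↪ Fin n)
    (σ : Equiv.Perm (Fin n)) (e : EdgeSet n) :
    edgePerm σ e ∈ copyEdges G (embeddingPerm m σ ψ) ↔ e ∈ copyEdges G ψ := by
  rw [mem_copyEdges, mem_copyEdges]
  refine exists₂_congr fun a b => and_congr_right fun _ => ?_
  rw [edgePerm_val]
  change e.1.map σ = (s(ψ a, ψ b)).map σ ↔ _
  exact (Sym2.map.injective σ.injective).eq_iff

open scoped Classical in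
/-- The number of copies of `G` containing the edge `e`. -/
noncomputable def copyCount (G : SimpleGraph (Fin m)) (e : EdgeSet n) : ℕ :=
  #{ψ : Fin m ↪ Fin n | e ∈ copyEdges G ψ}

lemma copyCount_edgePerm (G : SimpleGraph (Fin m)) (σ : Equiv.Perm (Fin n)) (e : EdgeSet n) :
    copyCount G (edgePerm σ e) = copyCount G e := by
  classical
  unfold copyCount
  refine (card_equiv (embeddingPerm m σ) fun ψ => ?_).symm
  simp [edgePerm_mem_copyEdges]

lemma card_edgeSet_mul_two (n : ℕ) : Fintype.card (EdgeSet n) * 2 = n.descFactorial 2 := by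
  rw [Sym2.card_subtype_not_diag, Fintype.card_fin, Nat.descFactorial_eq_factorial_mul_choose,
    Nat.factorial_two, mul_comm]

lemma two_le_of_numEdges_pos {G : SimpleGraph (Fin m)} (h : numEdges G ≠ 0) : 2 ≤ m := by
  by_contra hm
  have : Subsingleton (Fin m) := Fin.subsingleton_iff_le_one.2 (by omega)
  refine h ?_
  rw [numEdges, Set.ncard_eq_zero, Set.eq_empty_iff_forall_notMem]
  intro z hz
  induction z with
  | _ a b =>
    have hab : G.Adj a b := hz
    exact hab.ne (Subsingleton.elim a b)

lemma card_mul_copyCount (G : SimpleGraph (Fin m)) (e : EdgeSet n) :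
    Fintype.card (EdgeSet n) * copyCount G e = numEdges G * n.descFactorial m := by
  classical
  have h1 : ∑ f : EdgeSet n, copyCount G f = Fintype.card (EdgeSet n) * copyCount G e := by
    rw [sum_congr rfl fun f _ => ?_, sum_const, smul_eq_mul, card_univ]
    obtain ⟨σ, rfl⟩ := exists_edgePerm_eq e f
    exact copyCount_edgePerm G σ e
  rw [← h1]
  simp only [copyCount, card_filter]
  rw [sum_comm]
  simp only [← card_filter, filter_univ_mem, card_copyEdges, sum_const, card_univ,
    Fintype.card_embedding_eq, Fintype.card_fin, smul_eq_mul, mul_comm]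

lemma copyCount_eq (G : SimpleGraph (Fin m)) (e : EdgeSet n) :
    copyCount G e = 2 * numEdges G * (n - 2).descFactorial (m - 2) := by
  have h := card_mul_copyCount G e
  have h2 := card_edgeSet_mul_two n
  have hpos : 0 < Fintype.card (EdgeSet n) := Fintype.card_pos_iff.2 ⟨e⟩
  rcases eq_or_ne (numEdges G) 0 with h0 | h0
  · rw [h0] at h ⊢
    simp only [zero_mul, mul_zero] at h ⊢
    rcases Nat.mul_eq_zero.1 h with h | h
    · omega
    · exact h
  · obtain ⟨l, rfl⟩ := Nat.exists_eq_add_of_le' (two_le_of_numEdges_pos h0)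
    have hn : 2 ≤ n := by
      by_contra hn
      rw [Nat.descFactorial_of_lt (by omega)] at h2
      omega
    obtain ⟨k, rfl⟩ := Nat.exists_eq_add_of_le' hn
    have h3 : (k + 2).descFactorial (l + 2) = (k + 2).descFactorial 2 * k.descFactorial l := by
      rw [Nat.succ_descFactorial_succ (k + 1) (l + 1), Nat.succ_descFactorial_succ k l,
        Nat.succ_descFactorial_succ (k + 1) 1, Nat.succ_descFactorial_succ k 0,
        Nat.descFactorial_zero]
      ring
    rw [h3, ← h2] at h
    have h4 : Fintype.card (EdgeSet (k + 2)) * copyCount G e =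
        Fintype.card (EdgeSet (k + 2)) * (2 * numEdges G * k.descFactorial l) := by
      rw [h]; ring
    simpa using Nat.eq_of_mul_eq_mul_left hpos h4

/-- The ratio `(n - 2)(n - 3)⋯(n - m + 1) / n ^ (m - 2)`. -/
noncomputable def fallingRatio (m n : ℕ) : ℝ := ((n - 2).descFactorial (m - 2) : ℝ) / n ^ (m - 2)

lemma fallingRatio_le_one (m n : ℕ) : fallingRatio m n ≤ 1 := by
  refine div_le_one_of_le₀ ?_ (by positivity)
  exact_mod_cast ((n - 2).descFactorial_le_pow (m - 2)).trans
    (Nat.pow_le_pow_left (Nat.sub_le n 2) _)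

lemma tendsto_fallingRatio (m : ℕ) :
    Tendsto (fallingRatio m) atTop (nhds 1) := by
  have hlow : Tendsto (fun n : ℕ => (1 - (m : ℝ) / n) ^ (m - 2)) atTop (nhds 1) := by
    have h := ((tendsto_const_div_atTop_nhds_zero_nat (m : ℝ)).const_sub 1).pow (m - 2)
    simpa using h
  refine tendsto_of_tendsto_of_tendsto_of_le_of_le' hlow tendsto_const_nhds ?_
    (Eventually.of_forall fun n => fallingRatio_le_one m n)
  filter_upwards [eventually_ge_atTop (m + 2)] with n hn
  have hn0 : (0 : ℝ) < n := by exact_mod_cast (by omega : 0 < n)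
  rw [fallingRatio, one_sub_div hn0.ne', div_pow]
  refine div_le_div_of_nonneg_right ?_ (by positivity)
  have h1 : (n - m) ^ (m - 2) ≤ (n - 2).descFactorial (m - 2) := by
    rcases lt_or_ge m 2 with hm | hm
    · simp [Nat.sub_eq_zero_of_le hm.le]
    · exact (Nat.pow_le_pow_left (by omega) _).trans
        (Nat.pow_sub_le_descFactorial (n - 2) (m - 2))
  have h2 : ((n : ℝ) - m) = ((n - m : ℕ) : ℝ) := by rw [Nat.cast_sub (by omega)]
  rw [h2]
  exact_mod_cast h1

end Copies

/-! ### The exponential random graph as a Gibbs measure -/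

section Resample

variable {ι J : Type*} [Fintype ι] [DecidableEq ι] [Fintype J] {A : J → Finset ι} {w : J → ℝ}
  {q : ℝ}

lemma resampleList_energyDeriv (e : ι) :
    resampleList q univ.toList (energyDeriv A w e) =
      fun _ => ∑ j, if e ∈ A j then w j * q ^ (#(A j) - 1) else 0 := by
  have h1 : energyDeriv A w e =
      fun x => ∑ j, (fun x => (if e ∈ A j then w j else 0) * allInd ((A j).erase e) x) x := by
    funext x
    simp only [energyDeriv, ite_mul, zero_mul]
  rw [h1, resampleList_sum]
  funext x
  refine sum_congr rfl fun j _ => ?_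
  rw [resampleList_const_mul, resampleList_allInd _ _ fun f _ => mem_toList.2 (mem_univ f)]
  by_cases h : e ∈ A j
  · simp only [if_pos h, card_erase_of_mem h]
  · simp only [if_neg h, zero_mul]

lemma resampleList_energyDeriv₂ (e : ι) :
    resampleList q univ.toList (energyDeriv₂ A w e) =
      fun _ => ∑ j, if e ∈ A j then w j * (((#(A j) - 1 : ℕ) : ℝ) * q ^ (#(A j) - 1 - 1))
        else 0 := by
  have h1 : energyDeriv₂ A w e =
      fun x => ∑ j, (fun x => (if e ∈ A j then w j else 0) * (fun x => ∑ f ∈ (A j).erase e,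
        allInd (((A j).erase e).erase f) x) x) x := by
    funext x
    simp only [energyDeriv₂, ite_mul, zero_mul]
  rw [h1, resampleList_sum]
  funext x
  refine sum_congr rfl fun j _ => ?_
  rw [resampleList_const_mul, resampleList_sum]
  by_cases h : e ∈ A j
  · simp only [if_pos h]
    congr 1
    rw [← card_erase_of_mem h, ← nsmul_eq_mul, ← sum_const]
    refine sum_congr rfl fun f hf => ?_
    rw [resampleList_allInd _ _ fun f _ => mem_toList.2 (mem_univ f), card_erase_of_mem hf]
  · simp only [if_neg h, zero_mul]

end Resample

section Model

variable {n s : ℕ} {V : Fin s → ℕ} (G : ∀ i, SimpleGraph (Fin (V i))) (β : Fin s → ℝ)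

/-- The edge sets of all copies of the graphs `G i`. -/
noncomputable def copyFamily (n : ℕ) (j : Σ i, Fin (V i) ↪ Fin n) : Finset (EdgeSet n) :=
  copyEdges (G j.1) j.2

/-- The coefficients of the copies in the Hamiltonian. -/
noncomputable def copyWeight (V : Fin s → ℕ) (β : Fin s → ℝ) (n : ℕ)
    (j : Σ i, Fin (V i) ↪ Fin n) : ℝ :=
  β j.1 / n ^ (V j.1 - 2)

/-- The discrete derivative of the Hamiltonian. -/
noncomputable abbrev hamDeriv (e : EdgeSet n) (x : Config n) : ℝ :=
  energyDeriv (copyFamily G n) (copyWeight V β n) e x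

/-- The sum of the mixed second discrete derivatives of the Hamiltonian. -/
noncomputable abbrev hamDeriv₂ (e : EdgeSet n) (x : Config n) : ℝ :=
  energyDeriv₂ (copyFamily G n) (copyWeight V β n) e x

/-- The derivative of `Psi`. -/
noncomputable def PsiDeriv (q : ℝ) : ℝ :=
  ∑ i, 2 * β i * (numEdges (G i) : ℝ) *
    (((numEdges (G i) - 1 : ℕ) : ℝ) * q ^ (numEdges (G i) - 1 - 1))

/-- An upper bound for the influence of a single edge on all the others. -/
noncomputable def rowBound : ℝ := ∑ i, 2 * β i * (numEdges (G i) : ℝ) * numEdges (G i)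

lemma hasDerivAt_Psi (q : ℝ) : HasDerivAt (Psi V G β) (PsiDeriv G β q) q := by
  unfold PsiDeriv
  have h := HasDerivAt.fun_sum (u := (univ : Finset (Fin s))) fun i _ =>
    (hasDerivAt_pow (numEdges (G i) - 1) q).const_mul (2 * β i * (numEdges (G i) : ℝ))
  exact h

lemma continuous_Psi : Continuous (Psi V G β) :=
  continuous_iff_continuousAt.2 fun q => (hasDerivAt_Psi G β q).continuousAt

lemma continuous_PsiDeriv : Continuous (PsiDeriv G β) := by
  unfold PsiDeriv
  fun_prop

lemma ergmProb_eq_gibbs :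
    (ergmProb V G β : Config n → ℝ) = gibbs (copyFamily G n) (copyWeight V β n) := by
  have h : ∀ x : Config n, Hamiltonian V G β x = energy (copyFamily G n) (copyWeight V β n) x := by
    intro x
    rw [energy, Fintype.sum_sigma, Hamiltonian]
    refine sum_congr rfl fun i _ => ?_
    rw [NG_eq_sum_allInd, mul_div_right_comm, mul_sum]
    rfl
  funext x
  simp only [ergmProb, gibbs, h]

lemma card_copyFamily (j : Σ i, Fin (V i) ↪ Fin n) :
    #(copyFamily G n j) = numEdges (G j.1) := card_copyEdges _ _

lemma sum_copyFamily_mem (e : EdgeSet n) (c : Fin s → ℝ) :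
    ∑ j, (if e ∈ copyFamily G n j then copyWeight V β n j * c j.1 else 0) =
      ∑ i, 2 * β i * (numEdges (G i) : ℝ) * c i * fallingRatio (V i) n := by
  classical
  rw [Fintype.sum_sigma]
  refine sum_congr rfl fun i _ => ?_
  have h : ∑ ψ : Fin (V i) ↪ Fin n, (if e ∈ copyFamily G n ⟨i, ψ⟩ then
      copyWeight V β n ⟨i, ψ⟩ * c i else 0) = copyCount (G i) e * (β i / n ^ (V i - 2) * c i) := by
    rw [copyCount, ← nsmul_eq_mul, ← sum_const, sum_filter]
    rfl
  rw [h, copyCount_eq, fallingRatio]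
  push_cast
  ring

variable (hβ : ∀ i, 0 < β i)
include hβ

lemma copyWeight_nonneg (j : Σ i, Fin (V i) ↪ Fin n) : 0 ≤ copyWeight V β n j :=
  div_nonneg (hβ _).le (by positivity)

lemma coeff_nonneg (i : Fin s) : 0 ≤ 2 * β i * (numEdges (G i) : ℝ) :=
  mul_nonneg (mul_nonneg zero_le_two (hβ i).le) (Nat.cast_nonneg _)

lemma sum_copyFamily_mem_le (e : EdgeSet n) (c : Fin s → ℝ) (hc : ∀ i, 0 ≤ c i) :
    ∑ j, (if e ∈ copyFamily G n j then copyWeight V β n j * c j.1 else 0) ≤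
      ∑ i, 2 * β i * (numEdges (G i) : ℝ) * c i := by
  rw [sum_copyFamily_mem]
  exact sum_le_sum fun i _ => mul_le_of_le_one_right
    (mul_nonneg (coeff_nonneg G β hβ i) (hc i)) (fallingRatio_le_one _ _)

lemma PsiDeriv_nonneg {q : ℝ} (h0 : 0 ≤ q) : 0 ≤ PsiDeriv G β q :=
  sum_nonneg fun i _ => mul_nonneg (coeff_nonneg G β hβ i) (by positivity)

lemma rowBound_nonneg : 0 ≤ rowBound G β :=
  sum_nonneg fun i _ => mul_nonneg (coeff_nonneg G β hβ i) (Nat.cast_nonneg _)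

lemma resample_hamDeriv_le {q : ℝ} (h0 : 0 ≤ q) (e : EdgeSet n) (x : Config n) :
    resampleList q univ.toList (hamDeriv G β e) x ≤ Psi V G β q := by
  change resampleList q univ.toList (energyDeriv (copyFamily G n) (copyWeight V β n) e) x ≤ _
  rw [resampleList_energyDeriv]
  simp only [card_copyFamily]
  exact sum_copyFamily_mem_le G β hβ e (fun i => q ^ (numEdges (G i) - 1)) fun i => by positivity

lemma resample_hamDeriv₂_le {q : ℝ} (h0 : 0 ≤ q) (e : EdgeSet n) (x : Config n) :
    resampleList q univ.toList (hamDeriv₂ G β e) x ≤ PsiDeriv G β q := by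
  change resampleList q univ.toList (energyDeriv₂ (copyFamily G n) (copyWeight V β n) e) x ≤ _
  rw [resampleList_energyDeriv₂]
  simp only [card_copyFamily]
  exact sum_copyFamily_mem_le G β hβ e
    (fun i => ((numEdges (G i) - 1 : ℕ) : ℝ) * q ^ (numEdges (G i) - 1 - 1)) fun i => by positivity

omit hβ in
lemma eventually_le_resample_hamDeriv {q a : ℝ} (ha : a < Psi V G β q) :
    ∀ᶠ n : ℕ in atTop, ∀ (e : EdgeSet n) (x : Config n),
      a ≤ resampleList q univ.toList (hamDeriv G β e) x := by
  have h : Tendsto (fun n : ℕ => ∑ i, 2 * β i * (numEdges (G i) : ℝ) *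
      q ^ (numEdges (G i) - 1) * fallingRatio (V i) n) atTop (nhds (Psi V G β q)) := by
    have := tendsto_finsetSum (univ : Finset (Fin s)) fun i _ =>
      (tendsto_fallingRatio (V i)).const_mul (2 * β i * (numEdges (G i) : ℝ) *
        q ^ (numEdges (G i) - 1))
    simpa only [mul_one, Psi] using this
  filter_upwards [h.eventually_const_lt ha] with n hn e x
  change a ≤ resampleList q univ.toList (energyDeriv (copyFamily G n) (copyWeight V β n) e) x
  rw [resampleList_energyDeriv]
  simp only [card_copyFamily]
  rw [sum_copyFamily_mem G β e fun i => q ^ (numEdges (G i) - 1)]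
  exact hn.le

omit hβ in
lemma mem_copyFamily_edgePerm (σ : Equiv.Perm (Fin n)) (e : EdgeSet n)
    (j : Σ i, Fin (V i) ↪ Fin n) :
    edgePerm σ e ∈ copyFamily G n (Equiv.sigmaCongrRight (fun i => embeddingPerm (V i) σ) j) ↔
      e ∈ copyFamily G n j :=
  edgePerm_mem_copyEdges _ _ _ _

omit hβ in
lemma pairWeight_edgePerm (σ : Equiv.Perm (Fin n)) (e f : EdgeSet n) :
    pairWeight (copyFamily G n) (copyWeight V β n) (edgePerm σ e) (edgePerm σ f) =
      pairWeight (copyFamily G n) (copyWeight V β n) e f := by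
  refine (Fintype.sum_equiv (Equiv.sigmaCongrRight fun i => embeddingPerm (V i) σ) _ _
    fun j => ?_).symm
  simp only [mem_copyFamily_edgePerm]
  rfl

lemma sum_pairWeight_le (e : EdgeSet n) :
    ∑ f, pairWeight (copyFamily G n) (copyWeight V β n) e f ≤ rowBound G β := by
  refine le_trans (le_of_eq ?_) (sum_copyFamily_mem_le G β hβ e
    (fun i => (numEdges (G i) : ℝ)) fun i => Nat.cast_nonneg _)
  simp only [pairWeight]
  rw [sum_comm]
  refine sum_congr rfl fun j _ => ?_
  by_cases h : e ∈ copyFamily G n j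
  · simp only [h, true_and, if_true]
    rw [← sum_filter, sum_const, filter_univ_mem, card_copyFamily, nsmul_eq_mul, mul_comm]
  · simp only [h, false_and, if_false, sum_const_zero]

/-- The influences of all the edges on a given one are square summable, with sum `O(1/n)`. -/
lemma sum_sq_pairWeight_le (hn : 8 ≤ n) (e : EdgeSet n) :
    ∑ f, (if f = e then 0 else pairWeight (copyFamily G n) (copyWeight V β n) e f) ^ 2 ≤
      2 * rowBound G β ^ 2 / n := by
  have hB := rowBound_nonneg G β hβ
  have hw := copyWeight_nonneg (n := n) β hβ (V := V)
  have hn' : (8 : ℝ) ≤ n := by exact_mod_cast hn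
  have hn0 : (0 : ℝ) < n := by linarith
  have hp : ∀ f, 0 ≤ pairWeight (copyFamily G n) (copyWeight V β n) e f :=
    fun f => pairWeight_nonneg hw e f
  have hs := sum_pairWeight_le G β hβ e
  have hmax : ∀ f, f ≠ e → pairWeight (copyFamily G n) (copyWeight V β n) e f ≤
      2 * rowBound G β / n := fun f hf => by
    have h1 := sub_four_mul_le_sum _ (pairWeight_nonneg hw) (pairWeight_edgePerm G β) hf.symm
    have h2 := (sum_le_sum_of_subset_of_nonneg (erase_subset e univ) fun f _ _ => hp f).trans hs
    rw [le_div_iff₀ hn0]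
    nlinarith [hp f]
  calc _ ≤ ∑ f, 2 * rowBound G β / n * pairWeight (copyFamily G n) (copyWeight V β n) e f := by
        refine sum_le_sum fun f _ => ?_
        split_ifs with h
        · rw [zero_pow two_ne_zero]; exact mul_nonneg (by positivity) (hp f)
        · rw [sq]; exact mul_le_mul_of_nonneg_right (hmax f h) (hp f)
    _ ≤ 2 * rowBound G β / n * rowBound G β := by
        rw [← mul_sum]; exact mul_le_mul_of_nonneg_left hs (by positivity)
    _ = _ := by ring

end Model

/-! ### Bootstrapping the conditional edge probabilities -/

/-- An upward closed property which improves along the iterates of `φ` holds on the whole region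
above the unique fixed point of `φ`. -/
lemma forall_of_iterate {φ : ℝ → ℝ} (hc : Continuous φ) (hφ : φ 1 < 1) {p : ℝ}
    (hu : ∀ q, φ q = q → q = p) (hp0 : 0 ≤ p) {P : ℝ → Prop} (h1 : P 1)
    (hup : ∀ q r, q ≤ r → P q → P r)
    (hstep : ∀ q r, 0 ≤ q → q ≤ 1 → P q → φ q < r → P r) {q : ℝ} (hpq : p < q) : P q := by
  by_contra hq
  have hq1 : q < 1 := not_le.1 fun h => hq (hup 1 q h h1)
  let S : Set ℝ := {r | p ≤ r ∧ r ≤ 1 ∧ P r}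
  have hS1 : (1 : ℝ) ∈ S := ⟨(hpq.trans hq1).le, le_rfl, h1⟩
  have hlow : ∀ r ∈ S, q ≤ r := fun r hr => not_lt.1 fun h => hq (hup r q h.le hr.2.2)
  set a := sInf S with ha
  have hqa : q ≤ a := le_csInf ⟨1, hS1⟩ hlow
  have ha1 : a ≤ 1 := csInf_le ⟨q, hlow⟩ hS1
  have hφa : φ a < a := by
    by_contra h
    obtain ⟨z, hz, hz0⟩ := intermediate_value_Icc' ha1
      (hc.sub continuous_id).continuousOn (show (0 : ℝ) ∈ Set.Icc (φ 1 - 1) (φ a - a) from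
        ⟨by linarith, by linarith [not_lt.1 h]⟩)
    have := hu z (by simpa [sub_eq_zero] using hz0)
    linarith [hz.1]
  have hnhds : φ ⁻¹' Set.Iio a ∈ nhds a := hc.continuousAt.preimage_mem_nhds (Iio_mem_nhds hφa)
  obtain ⟨δ, hδ, hball⟩ := Metric.mem_nhds_iff.1 hnhds
  obtain ⟨r, hrS, hr⟩ := exists_lt_of_csInf_lt ⟨1, hS1⟩ (lt_add_of_pos_right (sInf S) hδ)
  have har : a ≤ r := csInf_le ⟨q, hlow⟩ hrS
  have hφr : φ r < a := hball (by
    rw [Metric.mem_ball, Real.dist_eq, abs_of_nonneg (by linarith)]; linarith)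
  obtain ⟨t, ht1, ht2⟩ := exists_between (max_lt hφr (hpq.trans_le hqa))
  have htS : t ∈ S := ⟨((le_max_right _ _).trans_lt ht1).le, ht2.le.trans ha1,
    hstep r t (hp0.trans hrS.1) hrS.2.1 hrS.2.2 ((le_max_left _ _).trans_lt ht1)⟩
  exact absurd (csInf_le ⟨q, hlow⟩ htS) (not_le.2 ht2)

section Bootstrap

variable {s : ℕ} {V : Fin s → ℕ} (G : ∀ i, SimpleGraph (Fin (V i))) (β : Fin s → ℝ)

/-- Under the exponential random graph measure, the statistics `F n e` exceed `ε` with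
probability smaller than any power of `n`, uniformly in `e`. -/
def Negligible (F : ∀ n, EdgeSet n → Config n → ℝ) (ε : ℝ) : Prop :=
  ∀ m : ℕ, ∀ᶠ n : ℕ in atTop, ∀ e : EdgeSet n,
    (n : ℝ) ^ m * mean (gibbs (copyFamily G n) (copyWeight V β n))
      (fun x => if ε < F n e x then 1 else 0) ≤ 1

variable {G β}

lemma Negligible.mono {F F' : ∀ n, EdgeSet n → Config n → ℝ} {ε ε' : ℝ}
    (h : Negligible G β F ε) (hF : ∀ n e x, ε' < F' n e x → ε < F n e x) :
    Negligible G β F' ε' := fun m => by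
  filter_upwards [h m] with n hn e
  refine le_trans (mul_le_mul_of_nonneg_left (isPMF_gibbs.mean_mono fun x => ?_)
    (by positivity)) (hn e)
  by_cases h' : ε' < F' n e x
  · rw [if_pos h', if_pos (hF n e x h')]
  · rw [if_neg h']; split_ifs <;> norm_num

lemma negligible_of_le {F : ∀ n, EdgeSet n → Config n → ℝ} {ε : ℝ}
    (hF : ∀ n e x, F n e x ≤ ε) : Negligible G β F ε := fun m => by
  refine Eventually.of_forall fun n e => ?_
  simp [fun x => not_lt.2 (hF n e x), mean]

lemma card_edgeSet_le (n : ℕ) : (Fintype.card (EdgeSet n) : ℝ) ≤ n ^ 2 := by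
  have h1 := card_edgeSet_mul_two n
  have h2 := n.descFactorial_le_pow 2
  exact_mod_cast (by omega : Fintype.card (EdgeSet n) ≤ n ^ 2)

lemma eventually_pow_mul_exp_le (m : ℕ) {b δ : ℝ} (hb : 0 < b) (hδ : 0 < δ) :
    ∀ᶠ n : ℕ in atTop, (n : ℝ) ^ m * Real.exp (-b * n) ≤ δ := by
  have h := (Real.tendsto_pow_mul_exp_neg_atTop_nhds_zero m).comp
    (tendsto_natCast_atTop_atTop.const_mul_atTop hb)
  have h2 := h.const_mul (b ^ m)⁻¹
  rw [mul_zero] at h2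
  filter_upwards [h2.eventually_lt_const hδ] with n hn
  refine le_trans (le_of_eq ?_) hn.le
  simp only [Function.comp_apply, mul_pow, neg_mul]
  field_simp

/-- The statistics of the exponential random graph concentrate as under the dominating (or
dominated) product measure. -/
lemma Negligible.tail (hβ : ∀ i, 0 < β i) {q σ : ℝ} (h0 : 0 ≤ q) (h1 : q ≤ 1)
    (hσ : σ = 1 ∨ σ = -1)
    (hq : Negligible G β (fun _ e x => σ * (Phi (hamDeriv G β e x) - q)) 0)
    {F : ∀ n, EdgeSet n → Config n → ℝ} {D : ℝ}
    (hF : ∀ n e f x, 0 ≤ F n e (Function.update x f true) - F n e (Function.update x f false) ∧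
      F n e (Function.update x f true) - F n e (Function.update x f false) ≤
        D * if f = e then 0 else pairWeight (copyFamily G n) (copyWeight V β n) e f)
    {a : ℝ} (hE : ∀ᶠ n : ℕ in atTop, ∀ (e : EdgeSet n) (x : Config n),
      σ * resampleList q univ.toList (F n e) x ≤ σ * a) {ε : ℝ} (hε : 0 < ε) :
    Negligible G β (fun n e x => σ * (F n e x - a)) ε := fun m => by
  set K : ℝ := D ^ 2 * (2 * rowBound G β ^ 2) + 1 with hK
  have hK0 : 0 < K := by positivity
  filter_upwards [hE, hq (m + 3), eventually_ge_atTop 8,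
    eventually_pow_mul_exp_le m (b := ε ^ 2 / (4 * K)) (δ := 1 / 2) (by positivity) (by norm_num)]
    with n hE hq hn hexp e
  have hn' : (8 : ℝ) ≤ n := by exact_mod_cast hn
  have hn0 : (0 : ℝ) < n := by linarith
  have hv : ∑ f, (D * if f = e then 0 else
      pairWeight (copyFamily G n) (copyWeight V β n) e f) ^ 2 ≤ K / n := by
    simp only [mul_pow, ← mul_sum]
    refine (mul_le_mul_of_nonneg_left (sum_sq_pairWeight_le G β hβ hn e) (sq_nonneg D)).trans ?_
    rw [← mul_div_assoc]
    exact div_le_div_of_nonneg_right (by linarith) hn0.le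
  have htail := mean_tail_le isPMF_gibbs
    (isCondProb_gibbs (copyFamily G n) (copyWeight V β n)) h0 h1 hσ (hF n e) hv
    (l := ε * n / (2 * K)) (ε := ε) (by positivity) (hE e)
  have hexp' : (ε * n / (2 * K)) ^ 2 * (K / n) - ε * n / (2 * K) * ε = -(ε ^ 2 / (4 * K)) * n := by
    field_simp; ring
  rw [hexp'] at htail
  refine (mul_le_mul_of_nonneg_left htail (by positivity)).trans ?_
  rw [mul_add]
  have hsum : (n : ℝ) ^ m * ∑ f, mean (gibbs (copyFamily G n) (copyWeight V β n)) (fun x =>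
      if 0 < σ * (Phi (hamDeriv G β f x) - q) then 1 else 0) ≤ 1 / 2 := by
    have h2 : ∀ f ∈ (univ : Finset (EdgeSet n)), (n : ℝ) ^ m *
        mean (gibbs (copyFamily G n) (copyWeight V β n)) (fun x =>
          if 0 < σ * (Phi (hamDeriv G β f x) - q) then 1 else 0) ≤ 1 / n ^ 3 := fun f _ => by
      rw [le_div_iff₀ (by positivity)]
      refine le_trans (le_of_eq ?_) (hq f)
      ring
    rw [mul_sum]
    refine (sum_le_sum h2).trans ?_
    rw [sum_const, nsmul_eq_mul, card_univ]
    refine (mul_le_mul_of_nonneg_right (card_edgeSet_le n) (by positivity)).trans ?_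
    have h3 : (n : ℝ) ^ 2 * (1 / n ^ 3) = 1 / n := by field_simp
    rw [h3]
    exact one_div_le_one_div_of_le two_pos (by linarith)
  linarith

lemma Negligible.hamDeriv_tail (hβ : ∀ i, 0 < β i) {q σ : ℝ} (h0 : 0 ≤ q) (h1 : q ≤ 1)
    (hσ : σ = 1 ∨ σ = -1)
    (hq : Negligible G β (fun _ e x => σ * (Phi (hamDeriv G β e x) - q)) 0)
    {ε : ℝ} (hε : 0 < ε) :
    Negligible G β (fun _ e x => σ * (hamDeriv G β e x - Psi V G β q)) ε := by
  have hE : ∀ᶠ n : ℕ in atTop, ∀ (e : EdgeSet n) (x : Config n),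
      σ * resampleList q univ.toList (hamDeriv G β e) x ≤ σ * (Psi V G β q + σ * (ε / 2)) := by
    rcases hσ with rfl | rfl
    · exact Eventually.of_forall fun n e x => by
        linarith [resample_hamDeriv_le G β hβ h0 e x]
    · filter_upwards [eventually_le_resample_hamDeriv G β
        (show Psi V G β q - ε / 2 < Psi V G β q by linarith)] with n hn e x
      linarith [hn e x]
  refine (hq.tail hβ h0 h1 hσ (F := fun _ e x => hamDeriv G β e x) (D := 1)
    (fun n e f x => ?_) hE (half_pos hε)).mono fun n e x h => ?_
  · rw [one_mul]
    exact energyDeriv_step (copyWeight_nonneg β hβ) e f x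
  · rcases hσ with rfl | rfl <;> linarith

lemma Negligible.step (hβ : ∀ i, 0 < β i) {q r σ : ℝ} (h0 : 0 ≤ q) (h1 : q ≤ 1)
    (hσ : σ = 1 ∨ σ = -1)
    (hq : Negligible G β (fun _ e x => σ * (Phi (hamDeriv G β e x) - q)) 0)
    (hr : 0 < σ * (r - phiFn V G β q)) :
    Negligible G β (fun _ e x => σ * (Phi (hamDeriv G β e x) - r)) 0 := by
  have hcont : Tendsto (fun ε : ℝ => σ * (r - Phi (Psi V G β q + σ * ε))) (nhdsWithin 0 (Set.Ioi 0))
      (nhds (σ * (r - phiFn V G β q))) := by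
    have h : Continuous fun ε : ℝ => σ * (r - Phi (Psi V G β q + σ * ε)) := by
      have := continuous_Phi
      fun_prop
    have h2 := h.tendsto 0
    rw [mul_zero, add_zero] at h2
    exact h2.mono_left nhdsWithin_le_nhds
  obtain ⟨ε, hε, hε0⟩ := ((hcont.eventually_const_lt hr).and self_mem_nhdsWithin).exists
  refine (hq.hamDeriv_tail hβ h0 h1 hσ hε0).mono fun n e x h => ?_
  rcases hσ with rfl | rfl
  · have h3 : Phi (Psi V G β q + 1 * ε) < Phi (hamDeriv G β e x) := by linarith
    linarith [Phi_strictMono.lt_iff_lt.1 h3]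
  · have h3 : Phi (hamDeriv G β e x) < Phi (Psi V G β q + -1 * ε) := by linarith
    linarith [Phi_strictMono.lt_iff_lt.1 h3]

lemma negligible_Phi_sub (hβ : ∀ i, 0 < β i) {p q σ : ℝ}
    (hp : phiFn V G β p = p) (hu : ∀ q, phiFn V G β q = q → q = p)
    (hσ : σ = 1 ∨ σ = -1) (hpq : 0 < σ * (q - p)) :
    Negligible G β (fun _ e x => σ * (Phi (hamDeriv G β e x) - q)) 0 := by
  have hc : Continuous (phiFn V G β) := continuous_Phi.comp (continuous_Psi G β)
  have hp0 : 0 < p := hp ▸ Phi_pos _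
  have hp1 : p < 1 := hp ▸ Phi_lt_one _
  rcases hσ with rfl | rfl
  · refine forall_of_iterate (P := fun q => Negligible G β
      (fun _ e x => 1 * (Phi (hamDeriv G β e x) - q)) 0) hc (Phi_lt_one _) hu hp0.le
      (negligible_of_le fun n e x => ?_) (fun q r hqr h => h.mono fun n e x hx => ?_)
      (fun q r h0 h1 h hr => h.step hβ h0 h1 (Or.inl rfl) (by linarith)) (by linarith)
    · linarith [Phi_lt_one (hamDeriv G β e x)]
    · linarith
  · have h := forall_of_iterate (φ := fun r => 1 - phiFn V G β (1 - r)) (p := 1 - p) (q := 1 - q)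
      (P := fun r => Negligible G β (fun _ e x => -1 * (Phi (hamDeriv G β e x) - (1 - r))) 0)
      (by fun_prop) (sub_lt_self _ (Phi_pos _))
      (fun r hr => by linarith [hu (1 - r) (by linarith)]) (by linarith)
      (negligible_of_le fun n e x => ?_) (fun q r hqr h => h.mono fun n e x hx => ?_)
      (fun q r h0 h1 h hr => h.step hβ (by linarith) (by linarith) (Or.inr rfl) (by linarith))
      (by linarith)
    · simpa using h
    · linarith [Phi_pos (hamDeriv G β e x)]
    · linarith

end Bootstrap

/-! ### Covariance of two edges -/

lemma allInd_congr {ι : Type*} {A B : Finset ι} {x y : ι → Bool}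
    (h : (∀ f ∈ A, x f = true) ↔ ∀ f ∈ B, y f = true) : allInd A x = allInd B y :=
  if_congr h rfl rfl

section Covariance

variable {n s : ℕ} {V : Fin s → ℕ} (G : ∀ i, SimpleGraph (Fin (V i))) (β : Fin s → ℝ)

lemma energy_comp_edgePerm (σ : Equiv.Perm (Fin n)) (x : Config n) :
    energy (copyFamily G n) (copyWeight V β n) (x ∘ edgePerm σ) =
      energy (copyFamily G n) (copyWeight V β n) x := by
  refine Fintype.sum_equiv (Equiv.sigmaCongrRight fun i => embeddingPerm (V i) σ) _ _ fun j => ?_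
  have h : allInd (copyFamily G n j) (x ∘ edgePerm σ) = allInd (copyFamily G n
      (Equiv.sigmaCongrRight (fun i => embeddingPerm (V i) σ) j)) x := by
    refine allInd_congr ⟨fun h f hf => ?_, fun h f hf =>
      h _ ((mem_copyFamily_edgePerm G σ f j).2 hf)⟩
    obtain ⟨f, rfl⟩ := (edgePerm σ).surjective f
    exact h f ((mem_copyFamily_edgePerm G σ f j).1 hf)
  rw [h]
  rfl

lemma mean_comp_edgePerm (σ : Equiv.Perm (Fin n)) (F : Config n → ℝ) :
    mean (gibbs (copyFamily G n) (copyWeight V β n)) (fun x => F (x ∘ edgePerm σ)) =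
      mean (gibbs (copyFamily G n) (copyWeight V β n)) F := by
  refine Fintype.sum_equiv (Equiv.arrowCongr (edgePerm σ).symm (Equiv.refl Bool)) _ _ fun x => ?_
  change _ = gibbs (copyFamily G n) (copyWeight V β n) (x ∘ edgePerm σ) * F (x ∘ edgePerm σ)
  simp only [gibbs, energy_comp_edgePerm]

lemma cov_bit_edgePerm (σ : Equiv.Perm (Fin n)) (e f : EdgeSet n) :
    cov (gibbs (copyFamily G n) (copyWeight V β n)) (bit (edgePerm σ e)) (bit (edgePerm σ f)) =
      cov (gibbs (copyFamily G n) (copyWeight V β n)) (bit e) (bit f) := by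
  have h := fun F => mean_comp_edgePerm G β σ F
  unfold cov
  rw [← h (bit e), ← h (bit f), ← h fun x => bit e x * bit f x]
  rfl

lemma cov_bit_sum (e : EdgeSet n) :
    Fintype.card (EdgeSet n) * ∑ f, cov (gibbs (copyFamily G n) (copyWeight V β n))
      (bit e) (bit f) = cov (gibbs (copyFamily G n) (copyWeight V β n))
        (fun x => ∑ f, bit f x) (fun x => ∑ f, bit f x) := by
  rw [cov_sum_left, ← nsmul_eq_mul, ← card_univ, ← sum_const]
  refine sum_congr rfl fun f _ => ?_
  rw [cov_sum_right]
  obtain ⟨σ, rfl⟩ := exists_edgePerm_eq e f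
  exact Fintype.sum_equiv (edgePerm σ) _ _ fun f => (cov_bit_edgePerm G β σ e f).symm

lemma cov_bit_le (hβ : ∀ i, 0 < β i) (hn : 8 ≤ n) {b : ℝ} {e f : EdgeSet n} (hef : e ≠ f)
    (hvar : cov (gibbs (copyFamily G n) (copyWeight V β n))
      (fun x => ∑ f, bit f x) (fun x => ∑ f, bit f x) ≤ Fintype.card (EdgeSet n) * b) :
    cov (gibbs (copyFamily G n) (copyWeight V β n)) (bit e) (bit f) ≤ 2 * b / n := by
  have hn' : (8 : ℝ) ≤ n := by exact_mod_cast hn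
  have h0 : ∀ e f : EdgeSet n,
      0 ≤ cov (gibbs (copyFamily G n) (copyWeight V β n)) (bit e) (bit f) :=
    fun e f => associated_gibbs (copyWeight_nonneg β hβ) _ _ (bit_mono e) (bit_mono f)
  have hM : (0 : ℝ) < Fintype.card (EdgeSet n) := by
    exact_mod_cast Fintype.card_pos_iff.2 ⟨e⟩
  rw [← cov_bit_sum G β e] at hvar
  have h1 := le_of_mul_le_mul_left hvar hM
  have h2 := sub_four_mul_le_sum _ h0 (cov_bit_edgePerm G β) hef
  have h3 := sum_le_sum_of_subset_of_nonneg (erase_subset e univ) fun f _ _ => h0 e f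
  rw [le_div_iff₀ (by linarith)]
  nlinarith [h0 e f]

end Covariance

section Subcritical

variable {s : ℕ} {V : Fin s → ℕ} {G : ∀ i, SimpleGraph (Fin (V i))} {β : Fin s → ℝ}

/-- Outside a negligible event the discrete derivatives of the Hamiltonian are close to their
values under the product measure with the critical density. -/
lemma Subcritical.exists_bounds (hβ : ∀ i, 0 < β i) {p : ℝ} (hsub : Subcritical V G β p) :
    ∃ lo hi κ τ : ℝ, 0 ≤ κ ∧ 0 ≤ τ ∧ κ * τ < 1 ∧
      (∀ u v, lo ≤ u → u ≤ v → v ≤ hi → Phi v - Phi u ≤ κ * (v - u)) ∧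
      Negligible G β (fun _ e x => hamDeriv G β e x) hi ∧
      Negligible G β (fun _ e x => -hamDeriv G β e x) (-lo) ∧
      Negligible G β (fun _ e x => hamDeriv₂ G β e x) τ := by
  obtain ⟨hp, hu, hd⟩ := hsub
  have hp0 : 0 < p := hp ▸ Phi_pos _
  have hp1 : p < 1 := hp ▸ Phi_lt_one _
  let dPhi : ℝ → ℝ := fun u => Phi u * (1 - Phi u)
  have hdPhi : Continuous dPhi := continuous_Phi.mul (continuous_const.sub continuous_Phi)
  have ht0 : 0 ≤ PsiDeriv G β p := PsiDeriv_nonneg G β hβ hp0.le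
  have ha0 : 0 < dPhi (Psi V G β p) := mul_pos (Phi_pos _) (sub_pos.2 (Phi_lt_one _))
  have hat : dPhi (Psi V G β p) * PsiDeriv G β p < 1 := by
    have h := (hasDerivAt_Phi (Psi V G β p)).comp p (hasDerivAt_Psi G β p)
    rw [← h.deriv]
    exact hd
  obtain ⟨δ, hδ, hδ0⟩ : ∃ δ : ℝ,
      (dPhi (Psi V G β p) + δ) * (PsiDeriv G β p + δ) < 1 ∧ 0 < δ := by
    have h : Continuous fun δ : ℝ => (dPhi (Psi V G β p) + δ) * (PsiDeriv G β p + δ) := by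
      fun_prop
    have h2 := h.tendsto 0
    rw [add_zero, add_zero] at h2
    exact (((h2.mono_left nhdsWithin_le_nhds).eventually_lt_const hat).and
      (self_mem_nhdsWithin (s := Set.Ioi (0 : ℝ)))).exists
  obtain ⟨η, hη, hηb⟩ := Metric.eventually_nhds_iff_ball.1
    (hdPhi.continuousAt.eventually_lt_const (lt_add_of_pos_right (dPhi (Psi V G β p)) hδ0))
  have hnear : ∀ᶠ q in nhds p, Psi V G β p - η / 4 < Psi V G β q ∧
      Psi V G β q < Psi V G β p + η / 4 ∧ PsiDeriv G β q < PsiDeriv G β p + δ / 2 ∧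
        0 < q ∧ q < 1 :=
    ((continuous_Psi G β).continuousAt.eventually_const_lt (by linarith)).and
      (((continuous_Psi G β).continuousAt.eventually_lt_const (by linarith)).and
        (((continuous_PsiDeriv G β).continuousAt.eventually_lt_const (by linarith)).and
          ((eventually_gt_nhds hp0).and (eventually_lt_nhds hp1))))
  obtain ⟨q, ⟨-, hq1, hq2, hq3, hq4⟩, hpq⟩ :=
    ((hnear.filter_mono nhdsWithin_le_nhds).and
      (self_mem_nhdsWithin (s := Set.Ioi p))).exists
  obtain ⟨r, ⟨hr1, -, -, hr3, hr4⟩, hpr⟩ :=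
    ((hnear.filter_mono nhdsWithin_le_nhds).and
      (self_mem_nhdsWithin (s := Set.Iio p))).exists
  have hpq' : p < q := hpq
  have hpr' : r < p := hpr
  have hnq := negligible_Phi_sub hβ hp hu (Or.inl rfl) (q := q) (by linarith)
  have hnr := negligible_Phi_sub hβ hp hu (Or.inr rfl) (q := r) (by linarith)
  refine ⟨Psi V G β p - η / 2, Psi V G β p + η / 2, dPhi (Psi V G β p) + δ, PsiDeriv G β p + δ,
    by linarith, by linarith, hδ, fun u v h1 h2 h3 => ?_, ?_, ?_, ?_⟩
  · refine (convex_Icc (Psi V G β p - η / 2) (Psi V G β p + η / 2)).image_sub_le_mul_sub_of_deriv_le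
      continuous_Phi.continuousOn differentiable_Phi.differentiableOn (fun z hz => ?_)
      u ⟨h1, h2.trans h3⟩ v ⟨h1.trans h2, h3⟩ h2
    rw [(hasDerivAt_Phi z).deriv]
    have hz' := interior_subset hz
    refine (hηb z ?_).le
    rw [Metric.mem_ball, Real.dist_eq, abs_lt]
    exact ⟨by linarith [hz'.1], by linarith [hz'.2]⟩
  · exact (hnq.hamDeriv_tail hβ hq3.le hq4.le (Or.inl rfl) (by linarith : 0 < η / 4)).mono
      fun n e x h => by linarith
  · exact (hnr.hamDeriv_tail hβ hr3.le hr4.le (Or.inr rfl) (by linarith : 0 < η / 4)).mono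
      fun n e x h => by linarith
  · have hcard : ∀ (n : ℕ) (j : Σ i, Fin (V i) ↪ Fin n),
        #(copyFamily G n j) ≤ ∑ i, numEdges (G i) := fun n j => by
      rw [card_copyFamily]
      exact single_le_sum (f := fun i => numEdges (G i)) (fun _ _ => Nat.zero_le _) (mem_univ _)
    exact (hnq.tail hβ hq3.le hq4.le (Or.inl rfl) (F := fun _ e x => hamDeriv₂ G β e x)
      (D := ((∑ i, numEdges (G i) : ℕ) : ℝ)) (a := PsiDeriv G β q)
      (fun n e f x => energyDeriv₂_step (copyWeight_nonneg β hβ) (hcard n) e f x)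
      (Eventually.of_forall fun n e x => by
        linarith [resample_hamDeriv₂_le G β hβ hq3.le e x])
      (half_pos hδ0)).mono fun n e x h => by linarith

lemma Subcritical.exists_cov_le (hβ : ∀ i, 0 < β i) {p : ℝ} (hsub : Subcritical V G β p) :
    ∃ C : ℝ, 0 < C ∧ ∀ᶠ n : ℕ in atTop, ∀ e f : EdgeSet n, e ≠ f →
      cov (gibbs (copyFamily G n) (copyWeight V β n)) (bit e) (bit f) ≤ C / n := by
  classical
  obtain ⟨lo, hi, κ, τ, hκ, hτ, hκτ, hΦ, hnhi, hnlo, hnτ⟩ := hsub.exists_bounds hβ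
  have hpos : 0 < 1 - κ * τ := sub_pos.2 hκτ
  refine ⟨2 * (2 / (1 - κ * τ)), by positivity, ?_⟩
  filter_upwards [hnhi 10, hnlo 10, hnτ 10, eventually_ge_atTop 8] with n hnhi hnlo hnτ hn e f hef
  have hn' : (8 : ℝ) ≤ n := by exact_mod_cast hn
  have hn0 : (0 : ℝ) < n := by linarith
  set μ := gibbs (copyFamily G n) (copyWeight V β n) with hμdef
  have hμ : IsPMF μ := isPMF_gibbs
  have hM1 : (1 : ℝ) ≤ Fintype.card (EdgeSet n) := by
    exact_mod_cast Fintype.card_pos_iff.2 ⟨e⟩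
  have hM2 := card_edgeSet_le n
  let P : Config n → Prop := fun x => ∀ e,
    lo ≤ hamDeriv G β e x ∧ hamDeriv G β e x ≤ hi ∧ hamDeriv₂ G β e x ≤ τ
  have hbad : mean μ (fun x => if P x then 0 else 1) ≤
      ∑ _e : EdgeSet n, (3 / (n : ℝ) ^ 10) := by
    have h1 : mean μ (fun x => if P x then 0 else 1) ≤ mean μ fun x => ∑ e,
        ((if hi < hamDeriv G β e x then (1 : ℝ) else 0) +
          (if -lo < -hamDeriv G β e x then (1 : ℝ) else 0) +
            (if τ < hamDeriv₂ G β e x then (1 : ℝ) else 0)) := by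
      refine hμ.mean_mono fun x => ?_
      have h0 : ∀ e ∈ (univ : Finset (EdgeSet n)),
          0 ≤ (if hi < hamDeriv G β e x then (1 : ℝ) else 0) +
            (if -lo < -hamDeriv G β e x then (1 : ℝ) else 0) +
              (if τ < hamDeriv₂ G β e x then (1 : ℝ) else 0) := fun e _ => by
        split_ifs <;> norm_num
      by_cases hP : P x
      · rw [if_pos hP]; exact sum_nonneg h0
      · rw [if_neg hP]
        obtain ⟨e, he⟩ := not_forall.1 hP
        refine le_trans ?_ (single_le_sum h0 (mem_univ e))
        by_cases a1 : hi < hamDeriv G β e x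
        · rw [if_pos a1]; split_ifs <;> norm_num
        · by_cases a2 : -lo < -hamDeriv G β e x
          · rw [if_neg a1, if_pos a2]; split_ifs <;> norm_num
          · have a3 : τ < hamDeriv₂ G β e x := not_le.1 fun h =>
              he ⟨by linarith [not_lt.1 a2], not_lt.1 a1, h⟩
            rw [if_pos a3]; split_ifs; norm_num
    refine h1.trans ?_
    rw [mean_sum]
    refine sum_le_sum fun e _ => ?_
    rw [mean_add, mean_add, le_div_iff₀ (by positivity)]
    have := hnhi e
    have := hnlo e
    have := hnτ e
    linarith
  have hbad' : 4 * (Fintype.card (EdgeSet n) : ℝ) ^ 2 *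
      mean μ (fun x => if P x then 0 else 1) ≤ 1 := by
    rw [sum_const, nsmul_eq_mul, card_univ] at hbad
    have hb2 : mean μ (fun x => if P x then 0 else 1) ≤ n ^ 2 * (3 / (n : ℝ) ^ 10) :=
      hbad.trans (mul_le_mul_of_nonneg_right hM2 (by positivity))
    have hM4 : (Fintype.card (EdgeSet n) : ℝ) ^ 2 ≤ (n ^ 2) ^ 2 :=
      pow_le_pow_left₀ (by linarith) hM2 2
    calc _ ≤ 4 * ((n : ℝ) ^ 2) ^ 2 * (n ^ 2 * (3 / (n : ℝ) ^ 10)) :=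
          mul_le_mul (by linarith) hb2 (hμ.mean_nonneg fun x => by split_ifs <;> norm_num)
            (by positivity)
      _ = 12 / n ^ 4 := by field_simp; norm_num
      _ ≤ 1 := by
        rw [div_le_one (by positivity)]
        exact le_trans (by norm_num) (pow_le_pow_left₀ (by norm_num) hn' 4)
  have hvar := variance_gibbs_le (copyWeight_nonneg β hβ) P (A := copyFamily G n)
    (fun x hx e => (hx e).1) (fun x hx e => (hx e).2.1) (fun x hx e => (hx e).2.2) hΦ hκ hτ hκτ.le
  refine cov_bit_le G β hβ hn hef ?_
  rw [← mul_div_assoc, le_div_iff₀ hpos]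
  linarith

end Subcritical

/-- **(Near-independence of edge moments: equation (720)).**
For every fixed `k ≥ 1` there is `C > 0` such that for all sufficiently large `n` and
any `k` distinct edges `i_1, …, i_k`,
`|𝔼[X_{i_1} ⋯ X_{i_k}] - 𝔼X_{i_1} ⋯ 𝔼X_{i_k}| ≤ C/n`. -/
theorem product_moment_factorization {s : ℕ} (V : Fin s → ℕ)
    (G : ∀ i, SimpleGraph (Fin (V i))) (β : Fin s → ℝ) (hβ : ∀ i, 0 < β i)
    (p : ℝ) (hsub : Subcritical V G β p) (k : ℕ) (hk : 0 < k) :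
    ∃ C : ℝ, 0 < C ∧ ∃ N : ℕ, ∀ n : ℕ, N ≤ n →
      ∀ i : Fin k → EdgeSet n, Function.Injective i →
        |expect (ergmProb V G β) (fun x => ∏ r : Fin k, edgeX (i r) x) -
            ∏ r : Fin k, expect (ergmProb V G β) (edgeX (i r))| ≤ C / (n : ℝ) := by
  obtain ⟨C, hC, hev⟩ := hsub.exists_cov_le hβ
  obtain ⟨N, hN⟩ := eventually_atTop.1 hev
  have hk' : (0 : ℝ) < k := Nat.cast_pos.2 hk
  refine ⟨(k : ℝ) ^ 2 * C, by positivity, N, fun n hn i hi => ?_⟩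
  rw [ergmProb_eq_gibbs]
  have h := (associated_gibbs (A := copyFamily G n)
    (copyWeight_nonneg (n := n) (V := V) β hβ)).abs_mean_prod_sub_le isPMF_gibbs i
    (δ := C / n) (by positivity) univ fun a _ b _ hab => hN n hn _ _ (hi.ne hab)
  rw [card_univ, Fintype.card_fin, ← mul_div_assoc] at h
  exact h

end ERGM
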